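/- arXiv:math/0212241 — 7 statements merged into one kernel-verified Lean document; each statement's English description precedes it below -/
import Mathlib

section
/- Let E be a directed graph, let P be a proper partition of E^1 (in the out-splitting sense), and let E_s(P) be the out-split graph formed from E using P. Let {s_f, p_w : f ∈ E_s(P)^1, w ∈ E_s(P)^0} be a Cuntz-Krieger E_s(P)-family in a C*-algebra A. For v ∈ E^0 and e ∈ E^1 define Q_v = p_v if m(v) = 0 and Q_v = Σ_{i=1}^{m(v)} p_{v^i} if m(v) ≠ 0, and define T_e = s_e if m(r(e)) = 0 and T_e = Σ_{j=1}^{m(r(e))} s_{e^j} if m(r(e)) ≠ 0 (all these sums are finite because P is proper). Then {T_e, Q_v : e ∈ E^1, v ∈ E^0} is a Cuntz-Krieger E-family in A; moreover, if every p_w is nonzero then every Q_v is nonzero. -/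
/-! Statement 0: An out-splitting of a directed graph sends Cuntz-Krieger families of the
out-split graph to Cuntz-Krieger families of the original graph. -/

/-- A Cuntz-Krieger family for the directed graph with vertex type `V`, edge type `E`,
range map `r` and source map `s`, inside a C*-algebra `A`.  The relation
`S e S e* ≤ P (s e)` is phrased algebraically (for projections `p ≤ q ↔ p * q = p`). -/
structure CKFamily {A : Type} [NonUnitalCStarAlgebra A] {V E : Type}
    (r s : E → V) (S : E → A) (P : V → A) : Prop where
  partialIsom : ∀ e, S e * star (S e) * S e = S e
  orthoRanges : ∀ e f, e ≠ f → (S e * star (S e)) * (S f * star (S f)) = 0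
  projIdem : ∀ v, P v * P v = P v
  projSelfAdj : ∀ v, star (P v) = P v
  orthoProj : ∀ v w, v ≠ w → P v * P w = 0
  ck1 : ∀ e, star (S e) * S e = P (r e)
  ck2 : ∀ e, (S e * star (S e)) * P (s e) = S e * star (S e)
  ck3 : ∀ v, {e | s e = v}.Nonempty → {e | s e = v}.Finite →
      P v = ∑ᶠ e ∈ {e | s e = v}, S e * star (S e)

section OutSplit

variable {V E : Type} (r s : E → V) (m : V → ℕ∞) (idx : E → ℕ)

/-- Vertices of the out-split graph `E_s(P)`: pairs `v^i = (v, i)` with `1 ≤ i ≤ m v`,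
together with the sinks `v`, encoded as `(v, 0)` when `m v = 0`. -/
def OSVert : Type :=
  {p : V × ℕ // (p.2 = 0 ∧ m p.1 = 0) ∨ (1 ≤ p.2 ∧ (p.2 : ℕ∞) ≤ m p.1)}

/-- Edges of the out-split graph: pairs `e^j = (e, j)` with `1 ≤ j ≤ m (r e)`, together
with the edges `e` into sinks, encoded as `(e, 0)` when `m (r e) = 0`. -/
def OSEdge : Type :=
  {p : E × ℕ // (p.2 = 0 ∧ m (r p.1) = 0) ∨ (1 ≤ p.2 ∧ (p.2 : ℕ∞) ≤ m (r p.1))}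

/-- The source map of the out-split graph: `s(e^j) = s(e)^{i}` where `e ∈ 𝓔^i_{s e}`,
i.e. `i = idx e`. -/
def osSrc (hidx : ∀ e, 1 ≤ idx e ∧ (idx e : ℕ∞) ≤ m (s e)) :
    OSEdge r m → OSVert m :=
  fun g => ⟨(s g.1.1, idx g.1.1), Or.inr (hidx g.1.1)⟩

/-- The range map of the out-split graph: `r(e^j) = r(e)^j` (and `r(e) = r(e)` for sinks). -/
def osRng : OSEdge r m → OSVert m := fun g => ⟨(r g.1.1, g.1.2), g.2⟩

variable {A : Type} [NonUnitalCStarAlgebra A]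

/-- `Q_v = p_v` if `m v = 0`, and `Q_v = ∑_{i=1}^{m v} p_{v^i}` otherwise. -/
noncomputable def QOS (p : OSVert m → A) (v : V) : A :=
  if h : m v = 0 then p ⟨(v, 0), Or.inl ⟨rfl, h⟩⟩
  else ∑ᶠ (k : ℕ) (hk : 1 ≤ k ∧ (k : ℕ∞) ≤ m v), p ⟨(v, k), Or.inr hk⟩

/-- `T_e = s_e` if `m (r e) = 0`, and `T_e = ∑_{j=1}^{m (r e)} s_{e^j}` otherwise. -/
noncomputable def TOS (S : OSEdge r m → A) (e : E) : A :=
  if h : m (r e) = 0 then S ⟨(e, 0), Or.inl ⟨rfl, h⟩⟩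
  else ∑ᶠ (j : ℕ) (hj : 1 ≤ j ∧ (j : ℕ∞) ≤ m (r e)), S ⟨(e, j), Or.inr hj⟩

end OutSplit

namespace CKFamily

variable {A : Type} [NonUnitalCStarAlgebra A] {V E : Type} {r s : E → V} {S : E → A} {P : V → A}

theorem star_mul_of_ne (h : CKFamily r s S P) {e f : E} (hef : e ≠ f) : star (S e) * S f = 0 := by
  have h1 : star (S e) = star (S e) * (S e * star (S e)) := by
    conv_lhs => rw [← h.partialIsom e]
    simp [mul_assoc]
  calc star (S e) * S f
      = star (S e) * (S e * star (S e)) * (S f * star (S f) * S f) := by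
        rw [h.partialIsom f, ← h1]
    _ = star (S e) * ((S e * star (S e)) * (S f * star (S f))) * S f := by
        simp only [mul_assoc]
    _ = 0 := by rw [h.orthoRanges e f hef]; simp

theorem mul_range (h : CKFamily r s S P) (e : E) : S e * P (r e) = S e := by
  rw [← h.ck1, ← mul_assoc, h.partialIsom]

theorem mul_of_ne (h : CKFamily r s S P) {e : E} {w : V} (hw : r e ≠ w) : S e * P w = 0 := by
  rw [← h.mul_range e, mul_assoc, h.orthoProj _ _ hw, mul_zero]

theorem mul_star_of_ne (h : CKFamily r s S P) {e f : E} (hef : r e ≠ r f) :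
    S e * star (S f) = 0 := by
  have h1 : P (r f) * star (S f) = star (S f) := by
    conv_rhs => rw [← h.mul_range f]
    rw [star_mul, h.projSelfAdj]
  rw [← h1, ← mul_assoc, h.mul_of_ne hef, zero_mul]

end CKFamily

section OutSplit

variable {V E : Type} {r s : E → V} {m : V → ℕ∞} {idx : E → ℕ}

/-- The finite set of indices of the copies of `v` in the out-split graph (when `m v` is finite). -/
def copyIndices (m : V → ℕ∞) (v : V) : Finset ℕ :=
  if m v = 0 then {0} else Finset.Icc 1 (m v).toNat

theorem mem_copyIndices {v : V} (hm : m v ≠ ⊤) {k : ℕ} :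
    k ∈ copyIndices m v ↔ (k = 0 ∧ m v = 0) ∨ (1 ≤ k ∧ (k : ℕ∞) ≤ m v) := by
  unfold copyIndices
  lift m v to ℕ using hm with n
  split_ifs with h
  · have : n = 0 := by exact_mod_cast h
    subst this
    simp
  · have : n ≠ 0 := by exact_mod_cast h
    simp [this]

theorem copyIndices_nonempty {v : V} (hm : m v ≠ ⊤) : (copyIndices m v).Nonempty := by
  unfold copyIndices
  lift m v to ℕ using hm with n
  split_ifs with h
  · simp
  · have : n ≠ 0 := by exact_mod_cast h
    simp
    omega

variable {A : Type} [NonUnitalCStarAlgebra A]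

open Classical in
/-- A family indexed by the out-split copies of elements of `X`, extended by zero. -/
noncomputable def copyExtend {X : Type} {C : X × ℕ → Prop} (f : {p : X × ℕ // C p} → A) (x : X)
    (k : ℕ) : A :=
  if h : C (x, k) then f ⟨(x, k), h⟩ else 0

theorem copyExtend_of {X : Type} {C : X × ℕ → Prop} (f : {p : X × ℕ // C p} → A) {x : X} {k : ℕ}
    (h : C (x, k)) : copyExtend f x k = f ⟨(x, k), h⟩ :=
  dif_pos h

theorem dite_finsum_eq_sum_copyIndices {v : V} (hm : m v ≠ ⊤) (f : ℕ → A) (a : m v = 0 → A)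
    (b : ∀ k : ℕ, 1 ≤ k ∧ (k : ℕ∞) ≤ m v → A) (ha : ∀ h, a h = f 0) (hb : ∀ k h, b k h = f k) :
    (if h : m v = 0 then a h else ∑ᶠ (k : ℕ) (hk : 1 ≤ k ∧ (k : ℕ∞) ≤ m v), b k hk) =
      ∑ k ∈ copyIndices m v, f k := by
  split_ifs with h
  · simp [copyIndices, h, ha]
  · simp only [hb]
    rw [← finsum_mem_coe_finset]
    refine finsum_congr fun k => ?_
    simp [mem_copyIndices hm, h]

theorem QOS_eq_sum (p : OSVert m → A) {v : V} (hm : m v ≠ ⊤) :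
    QOS m p v = ∑ k ∈ copyIndices m v, copyExtend p v k :=
  dite_finsum_eq_sum_copyIndices hm _ _ _
    (fun h => (copyExtend_of p (Or.inl ⟨rfl, h⟩)).symm)
    (fun _ h => (copyExtend_of p (Or.inr h)).symm)

theorem TOS_eq_sum (S : OSEdge r m → A) {e : E} (hm : m (r e) ≠ ⊤) :
    TOS r m S e = ∑ k ∈ copyIndices m (r e), copyExtend S e k :=
  dite_finsum_eq_sum_copyIndices hm _ _ _
    (fun h => (copyExtend_of S (Or.inl ⟨rfl, h⟩)).symm)
    (fun _ h => (copyExtend_of S (Or.inr h)).symm)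

variable {hidx : ∀ e, 1 ≤ idx e ∧ (idx e : ℕ∞) ≤ m (s e)} {Sp : OSEdge r m → A} {Pp : OSVert m → A}

theorem copyExtend_proj_mul (hm : ∀ v, m v ≠ ⊤)
    (hfam : CKFamily (osRng r m) (osSrc r s m idx hidx) Sp Pp) {v : V} {k : ℕ}
    (hk : k ∈ copyIndices m v) : copyExtend Pp v k * QOS m Pp v = copyExtend Pp v k := by
  rw [QOS_eq_sum Pp (hm v), Finset.mul_sum, Finset.sum_eq_single_of_mem k hk]
  · rw [copyExtend_of Pp ((mem_copyIndices (hm v)).1 hk)]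
    exact hfam.projIdem _
  · intro l hl hlk
    rw [copyExtend_of Pp ((mem_copyIndices (hm v)).1 hk),
      copyExtend_of Pp ((mem_copyIndices (hm v)).1 hl)]
    exact hfam.orthoProj _ _ fun h => hlk (congrArg (fun w => w.1.2) h).symm

theorem TOS_mul_star (hm : ∀ v, m v ≠ ⊤)
    (hfam : CKFamily (osRng r m) (osSrc r s m idx hidx) Sp Pp) (e : E) :
    TOS r m Sp e * star (TOS r m Sp e) =
      ∑ j ∈ copyIndices m (r e), copyExtend Sp e j * star (copyExtend Sp e j) := by
  rw [TOS_eq_sum Sp (hm _), star_sum, Finset.sum_mul_sum]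
  refine Finset.sum_congr rfl fun j hj => Finset.sum_eq_single_of_mem j hj fun l hl hlj => ?_
  rw [copyExtend_of Sp ((mem_copyIndices (hm _)).1 hj),
    copyExtend_of Sp ((mem_copyIndices (hm _)).1 hl)]
  exact hfam.mul_star_of_ne fun h => hlj (congrArg (fun w => w.1.2) h).symm

theorem star_TOS_mul_self (hm : ∀ v, m v ≠ ⊤)
    (hfam : CKFamily (osRng r m) (osSrc r s m idx hidx) Sp Pp) (e : E) :
    star (TOS r m Sp e) * TOS r m Sp e = QOS m Pp (r e) := by
  rw [TOS_eq_sum Sp (hm _), star_sum, Finset.sum_mul_sum, QOS_eq_sum Pp (hm _)]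
  refine Finset.sum_congr rfl fun j hj => ?_
  have hj' := (mem_copyIndices (hm _)).1 hj
  rw [Finset.sum_eq_single_of_mem j hj, copyExtend_of Sp hj', copyExtend_of Pp hj']
  · exact hfam.ck1 _
  · intro l hl hlj
    rw [copyExtend_of Sp hj', copyExtend_of Sp ((mem_copyIndices (hm _)).1 hl)]
    exact hfam.star_mul_of_ne fun h => hlj (congrArg (fun w => w.1.2) h).symm

theorem star_TOS_mul_of_ne (hm : ∀ v, m v ≠ ⊤)
    (hfam : CKFamily (osRng r m) (osSrc r s m idx hidx) Sp Pp) {e f : E} (hef : e ≠ f) :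
    star (TOS r m Sp e) * TOS r m Sp f = 0 := by
  rw [TOS_eq_sum Sp (hm _), TOS_eq_sum Sp (hm _), star_sum, Finset.sum_mul_sum]
  refine Finset.sum_eq_zero fun j hj => Finset.sum_eq_zero fun l hl => ?_
  rw [copyExtend_of Sp ((mem_copyIndices (hm _)).1 hj),
    copyExtend_of Sp ((mem_copyIndices (hm _)).1 hl)]
  exact hfam.star_mul_of_ne fun h => hef (congrArg (fun w => w.1.1) h)

theorem TOS_mul_QOS (hm : ∀ v, m v ≠ ⊤)
    (hfam : CKFamily (osRng r m) (osSrc r s m idx hidx) Sp Pp) (e : E) :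
    TOS r m Sp e * QOS m Pp (r e) = TOS r m Sp e := by
  rw [TOS_eq_sum Sp (hm _), Finset.sum_mul]
  refine Finset.sum_congr rfl fun j hj => ?_
  have hj' := (mem_copyIndices (hm _)).1 hj
  have h : copyExtend Sp e j * copyExtend Pp (r e) j = copyExtend Sp e j := by
    rw [copyExtend_of Sp hj', copyExtend_of Pp hj']
    exact hfam.mul_range _
  rw [← h, mul_assoc, copyExtend_proj_mul hm hfam hj]

theorem TOS_mul_star_mul_QOS (hm : ∀ v, m v ≠ ⊤)
    (hfam : CKFamily (osRng r m) (osSrc r s m idx hidx) Sp Pp) (e : E) :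
    TOS r m Sp e * star (TOS r m Sp e) * QOS m Pp (s e) =
      TOS r m Sp e * star (TOS r m Sp e) := by
  rw [TOS_mul_star hm hfam, Finset.sum_mul]
  refine Finset.sum_congr rfl fun j hj => ?_
  have hs : copyExtend Sp e j * star (copyExtend Sp e j) * copyExtend Pp (s e) (idx e) =
      copyExtend Sp e j * star (copyExtend Sp e j) := by
    rw [copyExtend_of Sp ((mem_copyIndices (hm _)).1 hj), copyExtend_of Pp (Or.inr (hidx e))]
    exact hfam.ck2 _
  rw [← hs, mul_assoc,
    copyExtend_proj_mul hm hfam ((mem_copyIndices (hm _)).2 (Or.inr (hidx e)))]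

theorem copyExtend_proj_eq_sum (hm : ∀ v, m v ≠ ⊤)
    (hfam : CKFamily (osRng r m) (osSrc r s m idx hidx) Sp Pp) {v : V} {k : ℕ}
    (hk : 1 ≤ k ∧ (k : ℕ∞) ≤ m v) (F : Finset E) (hF : ∀ e, e ∈ F ↔ s e = v ∧ idx e = k)
    (hne : F.Nonempty) :
    copyExtend Pp v k = ∑ e ∈ F, TOS r m Sp e * star (TOS r m Sp e) := by
  set G : Set (OSEdge r m) := {g | osSrc r s m idx hidx g = ⟨(v, k), Or.inr hk⟩} with hG
  have hmem : ∀ g : OSEdge r m, g ∈ G ↔ g.1.1 ∈ F := fun g => by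
    rw [hF]
    constructor
    · intro h
      exact ⟨congrArg (fun w => w.1.1) h, congrArg (fun w => w.1.2) h⟩
    · rintro ⟨h1, h2⟩
      exact Subtype.ext (Prod.ext h1 h2)
  let φ : OSEdge r m → Σ _ : E, ℕ := fun g => ⟨g.1.1, g.1.2⟩
  have hbij : Set.BijOn φ G ↑(F.sigma fun e => copyIndices m (r e)) := by
    refine ⟨fun g hg => ?_, fun g _ g' _ h => ?_, fun x hx => ?_⟩
    · simpa [φ] using ⟨(hmem g).1 hg, (mem_copyIndices (hm _)).2 g.2⟩
    · simp only [φ, Sigma.mk.injEq, heq_eq_eq] at h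
      exact Subtype.ext (Prod.ext h.1 h.2)
    · obtain ⟨h1, h2⟩ := Finset.mem_sigma.1 (Finset.mem_coe.1 hx)
      exact ⟨⟨(x.1, x.2), (mem_copyIndices (hm _)).1 h2⟩, (hmem _).2 h1, rfl⟩
  have hGne : G.Nonempty := by
    obtain ⟨e, he⟩ := hne
    obtain ⟨j, hj⟩ := copyIndices_nonempty (hm (r e))
    exact ⟨⟨(e, j), (mem_copyIndices (hm _)).1 hj⟩, (hmem _).2 he⟩
  have hGfin : G.Finite := hbij.finite_iff_finite.2 (Finset.finite_toSet _)
  rw [copyExtend_of Pp (Or.inr hk), Finset.sum_congr rfl fun e _ => TOS_mul_star hm hfam e,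
    Finset.sum_sigma', ← finsum_mem_coe_finset]
  refine (hfam.ck3 _ hGne hGfin).trans (finsum_mem_eq_of_bijOn φ hbij fun g _ => ?_)
  rw [copyExtend_of Sp g.2]
  rfl

end OutSplit

/-- Let `E` be a directed graph (with countable vertex and edge sets),
`𝓟` a proper partition of `E^1` (encoded by `m : V → ℕ∞` giving the number of partition
sets at each vertex and `idx : E → ℕ` giving the index of the partition set containing
each edge), and `E_s(𝓟)` the out-split graph.  If `{s_f, p_w}` is a Cuntz-Krieger
`E_s(𝓟)`-family in a C*-algebra `A` then `{T_e, Q_v}` is a Cuntz-Krieger `E`-family in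
`A`; moreover if every `p_w` is nonzero then every `Q_v` is nonzero. -/
theorem outsplit_CK_family {A : Type} [NonUnitalCStarAlgebra A]
    {V E : Type} [Countable V] [Countable E] (r s : E → V)
    (m : V → ℕ∞) (idx : E → ℕ)
    (hsink : ∀ v, m v = 0 ↔ {e | s e = v} = ∅)
    (hidx : ∀ e, 1 ≤ idx e ∧ (idx e : ℕ∞) ≤ m (s e))
    (hcls : ∀ v k, 1 ≤ k → (k : ℕ∞) ≤ m v → ∃ e, s e = v ∧ idx e = k)
    (hproper : ∀ v, {e | s e = v}.Infinite →
      m v ≠ ⊤ ∧ ∃! k : ℕ, {e | s e = v ∧ idx e = k}.Infinite)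
    (Sp : OSEdge r m → A) (Pp : OSVert m → A)
    (hfam : CKFamily (osRng r m) (osSrc r s m idx hidx) Sp Pp) :
    CKFamily r s (TOS r m Sp) (QOS m Pp) ∧
      ((∀ w, Pp w ≠ 0) → ∀ v, QOS m Pp v ≠ 0) := by
  classical
  have hm : ∀ v, m v ≠ ⊤ := by
    intro v hv
    obtain ⟨e, -, he⟩ := hcls v ⊤ le_top hv.ge
    exact ENat.natCast_ne_top _ he
  refine ⟨⟨fun e => ?_, fun e f hef => ?_, fun v => ?_, fun v => ?_, fun v w hvw => ?_,
    star_TOS_mul_self hm hfam, TOS_mul_star_mul_QOS hm hfam, fun v hne hfin => ?_⟩,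
    fun hP v hQ => ?_⟩
  · rw [mul_assoc, star_TOS_mul_self hm hfam, TOS_mul_QOS hm hfam]
  · rw [mul_assoc, ← mul_assoc (star _), star_TOS_mul_of_ne hm hfam hef, zero_mul, mul_zero]
  · nth_rewrite 1 [QOS_eq_sum Pp (hm v)]
    rw [Finset.sum_mul, Finset.sum_congr rfl fun k hk => copyExtend_proj_mul hm hfam hk, QOS_eq_sum Pp (hm v)]
  · rw [QOS_eq_sum Pp (hm v), star_sum]
    refine Finset.sum_congr rfl fun k hk => ?_
    rw [copyExtend_of Pp ((mem_copyIndices (hm v)).1 hk)]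
    exact hfam.projSelfAdj _
  · rw [QOS_eq_sum Pp (hm v), QOS_eq_sum Pp (hm w), Finset.sum_mul_sum]
    refine Finset.sum_eq_zero fun j hj => Finset.sum_eq_zero fun l hl => ?_
    rw [copyExtend_of Pp ((mem_copyIndices (hm v)).1 hj),
      copyExtend_of Pp ((mem_copyIndices (hm w)).1 hl)]
    exact hfam.orthoProj _ _ fun h => hvw (congrArg (fun w => w.1.1) h)
  · have h0 : m v ≠ 0 := fun h => hne.ne_empty ((hsink v).1 h)
    lift {e | s e = v} to Finset E using hfin with F hF
    have hF' : ∀ e, e ∈ F ↔ s e = v := fun e => by rw [← Finset.mem_coe, hF]; rfl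
    rw [finsum_mem_coe_finset, QOS_eq_sum Pp (hm v),
      ← Finset.sum_fiberwise_of_maps_to (t := copyIndices m v) (g := idx)
        fun e he => (mem_copyIndices (hm v)).2 (Or.inr ((hF' e).1 he ▸ hidx e))]
    refine Finset.sum_congr rfl fun k hk => ?_
    have hk' := ((mem_copyIndices (hm v)).1 hk).resolve_left fun h => h0 h.2
    refine copyExtend_proj_eq_sum hm hfam hk' _ (fun e => by simp [hF']) ?_
    obtain ⟨e, he⟩ := hcls v k (by exact_mod_cast hk'.1) hk'.2
    exact ⟨e, by simpa [hF'] using he⟩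
  · obtain ⟨k, hk⟩ := copyIndices_nonempty (hm v)
    have h := copyExtend_proj_mul hm hfam hk
    rw [hQ, mul_zero, copyExtend_of Pp ((mem_copyIndices (hm v)).1 hk)] at h
    exact hP _ h.symm
end

section
/- Let E be a directed graph, let P be a proper partition of E^1 (in the out-splitting sense), and let E_s(P) be the out-split graph formed from E using P. Let {s_f, p_w : f ∈ E_s(P)^1, w ∈ E_s(P)^0} be a Cuntz-Krieger E_s(P)-family in a C*-algebra A, and define Q_v (v ∈ E^0) and T_e (e ∈ E^1) by Q_v = p_v if m(v) = 0, Q_v = Σ_{i=1}^{m(v)} p_{v^i} if m(v) ≠ 0, T_e = s_e if m(r(e)) = 0, and T_e = Σ_{j=1}^{m(r(e))} s_{e^j} if m(r(e)) ≠ 0. Then every generator s_f (f ∈ E_s(P)^1) and every p_w (w ∈ E_s(P)^0) lies in C*(T_e, Q_v), the smallest norm-closed star-subalgebra of A containing all T_e and Q_v. -/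
section CKFamily

variable {A : Type} [NonUnitalCStarAlgebra A] {V E : Type} {r s : E → V} {S : E → A} {P : V → A}

theorem CKFamily.mul_proj (h : CKFamily r s S P) (e : E) : S e * P (r e) = S e := by
  rw [← h.ck1, ← mul_assoc, h.partialIsom]

theorem CKFamily.mul_star_eq_zero (h : CKFamily r s S P) {e f : E} (hef : r e ≠ r f) :
    S e * star (S f) = 0 := by
  rw [← h.mul_proj e, ← h.mul_proj f, star_mul, h.projSelfAdj, mul_assoc,
    ← mul_assoc (P (r e)), h.orthoProj _ _ hef, zero_mul, mul_zero]

/-- If `r` is injective on `F`, then `T = ∑ e ∈ F, S e` has range projection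
`∑ e ∈ F, S e * star (S e)`. -/
theorem CKFamily.sum_mul_star_sum (h : CKFamily r s S P) (F : Finset E)
    (hF : Set.InjOn r F) :
    (∑ e ∈ F, S e) * star (∑ e ∈ F, S e) = ∑ e ∈ F, S e * star (S e) := by
  rw [star_sum, Finset.sum_mul_sum]
  refine Finset.sum_congr rfl fun e he => ?_
  refine Finset.sum_eq_single_of_mem e he fun f hf hfe => h.mul_star_eq_zero fun hr => ?_
  exact hfe (hF hf he hr.symm)

theorem CKFamily.sum_mul_proj (h : CKFamily r s S P) (F : Finset E)
    (hF : Set.InjOn r F) {e : E} (he : e ∈ F) :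
    (∑ f ∈ F, S f) * P (r e) = S e := by
  rw [Finset.sum_mul, Finset.sum_eq_single_of_mem e he, h.mul_proj]
  intro f hf hfe
  rw [← h.mul_proj f, mul_assoc, h.orthoProj _ _ fun hr => hfe (hF hf he hr), mul_zero]

end CKFamily

section OutSplit

variable {V E : Type} {r s : E → V} {m : V → ℕ∞} {idx : E → ℕ}

theorem OSVert.finite_fiber {v : V} (hv : m v ≠ ⊤) : {w : OSVert m | w.1.1 = v}.Finite := by
  obtain ⟨n, hn⟩ := ENat.ne_top_iff_exists.mp hv
  refine Set.Finite.of_finite_image (f := fun w => w.1.2) ((Set.finite_Iic n).subset ?_) ?_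
  · rintro _ ⟨w, rfl, rfl⟩
    rcases w.2 with h | h
    · simp [h.1]
    · simpa [← hn] using h.2
  · rintro w hw w' hw' h
    exact Subtype.ext (Prod.ext (hw.trans hw'.symm) h)

theorem OSEdge.finite_fiber {e : E} (he : m (r e) ≠ ⊤) :
    {g : OSEdge r m | g.1.1 = e}.Finite :=
  OSVert.finite_fiber (m := m ∘ r) he

theorem QOS_eq_finsum_mem {A : Type} [NonUnitalCStarAlgebra A] (p : OSVert m → A) (v : V) :
    QOS m p v = ∑ᶠ w ∈ {w : OSVert m | w.1.1 = v}, p w := by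
  classical
  unfold QOS
  split_ifs with h
  · let w₀ : OSVert m := ⟨(v, 0), Or.inl ⟨rfl, h⟩⟩
    have : {w : OSVert m | w.1.1 = v} = {w₀} := by
      ext w
      refine ⟨?_, fun hw => by rw [Set.mem_singleton_iff.mp hw]; rfl⟩
      rintro rfl
      refine Subtype.ext (Prod.ext rfl ?_)
      rcases w.2 with h' | h'
      · exact h'.1
      · have h0 := h'.2
        simp only [h, nonpos_iff_eq_zero, Nat.cast_eq_zero] at h0
        exact h0
    rw [this, finsum_mem_singleton]
  · refine (finsum_dmem (s := {k : ℕ | 1 ≤ k ∧ (k : ℕ∞) ≤ m v})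
      fun k hk => p ⟨(v, k), Or.inr hk⟩).trans ?_
    symm
    refine finsum_mem_eq_of_bijOn (fun w => w.1.2) ⟨?_, ?_, ?_⟩ ?_
    · rintro w rfl
      exact w.2.resolve_left fun h' => h h'.2
    · rintro w hw w' hw' hww
      exact Subtype.ext (Prod.ext (hw.trans hw'.symm) hww)
    · exact fun k hk => ⟨⟨(v, k), Or.inr hk⟩, rfl, rfl⟩
    · rintro w rfl
      have hw : w.1.2 ∈ {k : ℕ | 1 ≤ k ∧ (k : ℕ∞) ≤ m w.1.1} :=
        w.2.resolve_left fun h' => h h'.2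
      rw [dif_pos hw]
      rfl

theorem TOS_eq_finsum_mem {A : Type} [NonUnitalCStarAlgebra A] (S : OSEdge r m → A) (e : E) :
    TOS r m S e = ∑ᶠ g ∈ {g : OSEdge r m | g.1.1 = e}, S g :=
  QOS_eq_finsum_mem (m := m ∘ r) S e

theorem osRng_injOn_fiber (e : E) : Set.InjOn (osRng r m) {g : OSEdge r m | g.1.1 = e} := by
  intro g hg g' hg' h
  exact Subtype.ext (Prod.ext (hg.trans hg'.symm) (congrArg (fun w => w.1.2) h))

variable {A : Type} [NonUnitalCStarAlgebra A]
  {hidx : ∀ e, 1 ≤ idx e ∧ (idx e : ℕ∞) ≤ m (s e)}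
  {Sp : OSEdge r m → A} {Pp : OSVert m → A}

theorem CKFamily.TOS_mul_star_TOS (h : CKFamily (osRng r m) (osSrc r s m idx hidx) Sp Pp)
    {e : E} (he : m (r e) ≠ ⊤) :
    TOS r m Sp e * star (TOS r m Sp e) =
      ∑ g ∈ (OSEdge.finite_fiber he).toFinset, Sp g * star (Sp g) := by
  rw [TOS_eq_finsum_mem, finsum_mem_eq_finite_toFinset_sum _ (OSEdge.finite_fiber he),
    h.sum_mul_star_sum]
  simpa using osRng_injOn_fiber e

theorem CKFamily.TOS_mul_proj (h : CKFamily (osRng r m) (osSrc r s m idx hidx) Sp Pp)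
    (g : OSEdge r m) (hg : m (r g.1.1) ≠ ⊤) :
    TOS r m Sp g.1.1 * Pp (osRng r m g) = Sp g := by
  rw [TOS_eq_finsum_mem, finsum_mem_eq_finite_toFinset_sum _ (OSEdge.finite_fiber hg),
    h.sum_mul_proj]
  · simpa using osRng_injOn_fiber g.1.1
  · simp

/-- At a vertex `v^i` with `𝓔^i_v` finite and nonempty, `p_{v^i} = ∑_{e ∈ 𝓔^i_v} T_e T_e*`. -/
theorem CKFamily.proj_eq_sum_TOS (h : CKFamily (osRng r m) (osSrc r s m idx hidx) Sp Pp)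
    (htop : ∀ v, m v ≠ ⊤) {w : OSVert m} (hne : {e | s e = w.1.1 ∧ idx e = w.1.2}.Nonempty)
    (hfin : {e | s e = w.1.1 ∧ idx e = w.1.2}.Finite) :
    Pp w = ∑ e ∈ hfin.toFinset, TOS r m Sp e * star (TOS r m Sp e) := by
  classical
  have hsrc : ∀ g : OSEdge r m,
      osSrc r s m idx hidx g = w ↔ s g.1.1 = w.1.1 ∧ idx g.1.1 = w.1.2 := fun g =>
    ⟨fun hg => hg ▸ ⟨rfl, rfl⟩, fun hg => Subtype.ext (Prod.ext hg.1 hg.2)⟩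
  have hfin' : {g | osSrc r s m idx hidx g = w}.Finite := by
    refine (hfin.biUnion fun e _ => OSEdge.finite_fiber (htop (r e))).subset fun g hg => ?_
    exact Set.mem_biUnion ((hsrc g).mp hg) rfl
  have hne' : {g | osSrc r s m idx hidx g = w}.Nonempty := by
    obtain ⟨e, he⟩ := hne
    by_cases h0 : m (r e) = 0
    · exact ⟨⟨(e, 0), Or.inl ⟨rfl, h0⟩⟩, (hsrc _).mpr he⟩
    · refine ⟨⟨(e, 1), Or.inr ⟨le_rfl, ?_⟩⟩, (hsrc _).mpr he⟩
      simpa [Order.one_le_iff_ne_zero] using h0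
  rw [h.ck3 w hne' hfin', finsum_mem_eq_finite_toFinset_sum _ hfin',
    ← Finset.sum_fiberwise_of_maps_to (g := fun g : OSEdge r m => g.1.1) (t := hfin.toFinset)]
  · refine Finset.sum_congr rfl fun e he => ?_
    rw [h.TOS_mul_star_TOS (htop (r e))]
    refine Finset.sum_congr ?_ fun _ _ => rfl
    ext g
    simp only [Finset.mem_filter, Set.Finite.mem_toFinset, Set.mem_ofPred_eq, hsrc] at he ⊢
    exact ⟨fun hg => hg.2, fun hg => ⟨hg ▸ he, hg⟩⟩
  · intro g hg
    simpa [hsrc] using hg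

end OutSplit

/-- With the notation of Statement 0 (out-split graph of a proper
partition, and `T_e`, `Q_v` defined from a Cuntz-Krieger `E_s(𝓟)`-family `{s_f, p_w}`),
every generator `s_f` and every `p_w` lies in `C*(T_e, Q_v)`, the smallest norm-closed
star-subalgebra of `A` containing all the `T_e` and `Q_v`. -/
theorem outsplit_generators_mem {A : Type} [NonUnitalCStarAlgebra A]
    {V E : Type} [Countable V] [Countable E] (r s : E → V)
    (m : V → ℕ∞) (idx : E → ℕ)
    (hsink : ∀ v, m v = 0 ↔ {e | s e = v} = ∅)
    (hidx : ∀ e, 1 ≤ idx e ∧ (idx e : ℕ∞) ≤ m (s e))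
    (hcls : ∀ v k, 1 ≤ k → (k : ℕ∞) ≤ m v → ∃ e, s e = v ∧ idx e = k)
    (hproper : ∀ v, {e | s e = v}.Infinite →
      m v ≠ ⊤ ∧ ∃! k : ℕ, {e | s e = v ∧ idx e = k}.Infinite)
    (Sp : OSEdge r m → A) (Pp : OSVert m → A)
    (hfam : CKFamily (osRng r m) (osSrc r s m idx hidx) Sp Pp) :
    (∀ f : OSEdge r m, Sp f ∈
      (NonUnitalStarAlgebra.adjoin ℂ
        (Set.range (TOS r m Sp) ∪ Set.range (QOS m Pp))).topologicalClosure) ∧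
    (∀ w : OSVert m, Pp w ∈
      (NonUnitalStarAlgebra.adjoin ℂ
        (Set.range (TOS r m Sp) ∪ Set.range (QOS m Pp))).topologicalClosure) := by
  set B := (NonUnitalStarAlgebra.adjoin ℂ
    (Set.range (TOS r m Sp) ∪ Set.range (QOS m Pp))).topologicalClosure
  have hsub : Set.range (TOS r m Sp) ∪ Set.range (QOS m Pp) ⊆ B := fun x hx =>
    NonUnitalStarSubalgebra.le_topologicalClosure _ (NonUnitalStarAlgebra.subset_adjoin ℂ _ hx)
  have hT : ∀ e, TOS r m Sp e ∈ B := fun e => hsub (Or.inl ⟨e, rfl⟩)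
  have hQ : ∀ v, QOS m Pp v ∈ B := fun v => hsub (Or.inr ⟨v, rfl⟩)
  have htop : ∀ v, m v ≠ ⊤ := fun v hv => by
    obtain ⟨e, -, he⟩ := hcls v ⊤ le_top hv.ge
    exact ENat.natCast_ne_top _ he
  have hfinite : ∀ w : OSVert m, 1 ≤ w.1.2 →
      {e | s e = w.1.1 ∧ idx e = w.1.2}.Finite → Pp w ∈ B := fun w hw hfin => by
    have hle := (w.2.resolve_left (by omega)).2
    obtain ⟨e, he, hk⟩ := hcls _ _ (by exact_mod_cast hw) hle
    rw [hfam.proj_eq_sum_TOS htop ⟨e, he, by exact_mod_cast hk⟩ hfin]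
    exact sum_mem fun e _ => mul_mem (hT e) (star_mem (hT e))
  have hP : ∀ w, Pp w ∈ B := fun w => by
    classical
    by_cases hw : 1 ≤ w.1.2 ∧ {e | s e = w.1.1 ∧ idx e = w.1.2}.Finite
    · exact hfinite w hw.1 hw.2
    have hothers : ∀ w' : OSVert m, w'.1.1 = w.1.1 → w' ≠ w → Pp w' ∈ B := by
      intro w' hv hne
      have hne2 : w'.1.2 ≠ w.1.2 := fun h => hne (Subtype.ext (Prod.ext hv h))
      rcases w.2 with h0 | h1
      · rcases w'.2 with h0' | h1'
        · exact absurd (h0'.1.trans h0.1.symm) hne2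
        · have h2 := h1'.2
          rw [hv, h0.2, nonpos_iff_eq_zero, Nat.cast_eq_zero] at h2
          omega
      · have hinf : {e | s e = w.1.1 ∧ idx e = w.1.2}.Infinite := fun hf => hw ⟨h1.1, hf⟩
        have hw' : 1 ≤ w'.1.2 := by
          rcases w'.2 with h0' | h1'
          · have h2 := h1.2
            rw [← hv, h0'.2, nonpos_iff_eq_zero, Nat.cast_eq_zero] at h2
            omega
          · exact h1'.1
        refine hfinite w' hw' (by_contra fun hf => hne2 ?_)
        exact (hproper w.1.1 (hinf.mono fun e he => he.1)).2.unique (hv ▸ hf) hinf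
    have hwF : w ∈ (OSVert.finite_fiber (htop w.1.1)).toFinset := by simp
    have hsum : QOS m Pp w.1.1 = _ := (QOS_eq_finsum_mem Pp w.1.1).trans
      (finsum_mem_eq_finite_toFinset_sum _ (OSVert.finite_fiber (htop w.1.1)))
    rw [← Finset.add_sum_erase _ _ hwF] at hsum
    rw [← sub_eq_of_eq_add hsum]
    refine sub_mem (hQ _) (sum_mem fun w' hw' => ?_)
    rw [Finset.mem_erase, Set.Finite.mem_toFinset] at hw'
    exact hothers w' hw'.2 hw'.1
  refine ⟨fun g => ?_, hP⟩
  rw [← hfam.TOS_mul_proj g (htop _)]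
  exact mul_mem (hT _) (hP _)
end

section
/- Let E be a directed graph, let d_s be a Drinen source-vector for E, and let d_s(E) be the out-delayed graph. Let {s_f, p_w : f ∈ d_s(E)^1, w ∈ d_s(E)^0} be a Cuntz-Krieger d_s(E)-family in a C*-algebra A. For v ∈ E^0 and e ∈ E^1 define Q_v = p_{v^0}, T_e = s_e if d_s(e) = 0, and T_e = s_{f(s(e))^1} ⋯ s_{f(s(e))^{d_s(e)}} s_e if d_s(e) ≠ 0. Then {T_e, Q_v : e ∈ E^1, v ∈ E^0} is a Cuntz-Krieger E-family in A; moreover, if every p_w is nonzero then every Q_v is nonzero. -/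
section OutDelay

variable {V E : Type} (r s : E → V) (d : V → ℕ∞) (dE : E → ℕ)

/-- Vertices of the out-delayed graph `d_s(E)`: pairs `v^i = (v, i)` with
`0 ≤ i ≤ d_s v`. -/
def ODVert : Type := {p : V × ℕ // (p.2 : ℕ∞) ≤ d p.1}

/-- Edges of the out-delayed graph: the original edges `e ∈ E^1` together with the
delay edges `f(v)^i`, `1 ≤ i ≤ d_s v`, encoded as pairs `(v, i)`. -/
def ODEdge (E : Type) {V : Type} (d : V → ℕ∞) : Type :=
  E ⊕ {p : V × ℕ // 1 ≤ p.2 ∧ (p.2 : ℕ∞) ≤ d p.1}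

/-- The vertex `v^0` of the out-delayed graph. -/
def odVert0 (v : V) : ODVert d := ⟨(v, 0), by simp⟩

/-- The source map of the out-delayed graph: `s(e) = s(e)^{d_s e}` and
`s(f(v)^i) = v^{i-1}`.  (The hypothesis `hsd`, that `d_s e ≤ d_s (s e)`, is a
consequence of the definition of a Drinen source-vector.) -/
def odSrc (hsd : ∀ e, (dE e : ℕ∞) ≤ d (s e)) : ODEdge E d → ODVert d
  | .inl e => ⟨(s e, dE e), hsd e⟩
  | .inr g => ⟨(g.1.1, g.1.2 - 1), le_trans (by exact_mod_cast Nat.sub_le _ _) g.2.2⟩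

/-- The range map of the out-delayed graph: `r(e) = r(e)^0` and `r(f(v)^i) = v^i`. -/
def odRng : ODEdge E d → ODVert d
  | .inl e => odVert0 d (r e)
  | .inr g => ⟨g.1, g.2.2⟩

variable {A : Type} [Mul A]

/-- `chainR x g n = g 1 * g 2 * ⋯ * g n * x` (and `chainR x g 0 = x`). -/
def chainR (x : A) : (ℕ → A) → ℕ → A
  | _, 0 => x
  | g, n + 1 => g 1 * chainR x (fun k => g (k + 1)) n

end OutDelay

section OutDelayFamily

variable {V E : Type} (r s : E → V) (d : V → ℕ∞) (dE : E → ℕ)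
variable {A : Type} [NonUnitalCStarAlgebra A]

open scoped Classical in
/-- `T_e = s_{f(s e)^1} ⋯ s_{f(s e)^{d_s e}} * s_e` (and `T_e = s_e` when `d_s e = 0`). -/
noncomputable def TOD (S : ODEdge E d → A) (e : E) : A :=
  chainR (S (.inl e))
    (fun k => if h : 1 ≤ k ∧ (k : ℕ∞) ≤ d (s e) then S (.inr ⟨(s e, k), h⟩) else 0)
    (dE e)

/-- `Q_v = p_{v^0}`. -/
noncomputable def QOD (P : ODVert d → A) (v : V) : A := P (odVert0 d v)

end OutDelayFamily

section DelayPath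

variable {A : Type} [NonUnitalSemiring A]

/-- `delayPath a g n = a * g 1 * ⋯ * g n`. -/
def delayPath (a : A) (g : ℕ → A) : ℕ → A
  | 0 => a
  | n + 1 => delayPath a g n * g (n + 1)

theorem delayPath_mul_shift (a : A) (g : ℕ → A) (n : ℕ) :
    delayPath (a * g 1) (fun k => g (k + 1)) n = delayPath a g (n + 1) := by
  induction n with
  | zero => rfl
  | succ n ih => rw [delayPath, ih, delayPath.eq_2 a g (n + 1)]

theorem mul_chainR (a x : A) (g : ℕ → A) (n : ℕ) :
    a * chainR x g n = delayPath a g n * x := by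
  induction n generalizing a g with
  | zero => rfl
  | succ n ih => rw [chainR, ← mul_assoc, ih, delayPath_mul_shift]

variable [StarRing A]

/-- A sequence of partial isometries `g 1, g 2, …` along a path whose vertices carry the
projections `p 0, p 1, …`. -/
structure IsDelaySeq (p g : ℕ → A) : Prop where
  idem : ∀ k, p k * p k = p k
  selfAdj : ∀ k, star (p k) = p k
  star_mul_self : ∀ k, star (g (k + 1)) * g (k + 1) = p (k + 1)
  left_mul : ∀ k, p k * g (k + 1) = g (k + 1)
  right_mul : ∀ k, g (k + 1) * p (k + 1) = g (k + 1)

namespace IsDelaySeq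

variable {p g : ℕ → A} (h : IsDelaySeq p g)
include h

theorem mul_delayPath (n : ℕ) : p 0 * delayPath (p 0) g n = delayPath (p 0) g n := by
  induction n with
  | zero => exact h.idem 0
  | succ n ih => rw [delayPath, ← mul_assoc, ih]

theorem delayPath_mul (n : ℕ) : delayPath (p 0) g n * p n = delayPath (p 0) g n := by
  cases n with
  | zero => exact h.idem 0
  | succ n => rw [delayPath, mul_assoc, h.right_mul]

theorem star_delayPath_mul_self (n : ℕ) :
    star (delayPath (p 0) g n) * delayPath (p 0) g n = p n := by
  induction n with
  | zero => rw [delayPath, h.selfAdj, h.idem]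
  | succ n ih =>
    rw [delayPath, star_mul, mul_assoc, ← mul_assoc (star (delayPath _ _ _)), ih, h.left_mul,
      h.star_mul_self]

theorem exists_star_delayPath_mul (m k : ℕ) :
    ∃ y, star (delayPath (p 0) g m) * delayPath (p 0) g (m + 1 + k) = g (m + 1) * y := by
  induction k with
  | zero =>
    refine ⟨p (m + 1), ?_⟩
    rw [h.right_mul, add_zero, delayPath, ← mul_assoc, h.star_delayPath_mul_self, h.left_mul]
  | succ k ih =>
    obtain ⟨y, hy⟩ := ih
    refine ⟨y * g (m + 1 + k + 1), ?_⟩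
    rw [← add_assoc, delayPath, ← mul_assoc, hy, mul_assoc]

theorem chainR_eq (x : A) (n : ℕ) (hx : p n * x = x) :
    chainR x g n = delayPath (p 0) g n * x := by
  rw [← mul_chainR]
  cases n with
  | zero => exact hx.symm
  | succ n => rw [chainR, ← mul_assoc, h.left_mul]

/-- If every `p n` decomposes as `g (n + 1) (g (n + 1))*` plus a finite sum of range projections
indexed by the fibre of `c` over `n`, then `p 0` decomposes accordingly along the path. -/
theorem eq_delayPath_add_sum {ι : Type*} (I : Finset ι) (c : ι → ℕ) (x : ι → A) (N : ℕ)
    (hp : ∀ n < N, p n = g (n + 1) * star (g (n + 1)) + ∑ i ∈ I with c i = n, x i * star (x i))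
    (n : ℕ) (hn : n ≤ N) :
    p 0 = delayPath (p 0) g n * star (delayPath (p 0) g n) +
      ∑ i ∈ I with c i < n, (delayPath (p 0) g (c i) * x i) *
        star (delayPath (p 0) g (c i) * x i) := by
  classical
  induction n with
  | zero => simp [delayPath, h.selfAdj, h.idem]
  | succ n ih =>
    have hsplit : (I.filter fun i => c i < n + 1) =
        (I.filter fun i => c i = n) ∪ I.filter fun i => c i < n := by
      ext i
      simp only [Finset.mem_filter, Finset.mem_union]
      grind
    have hdisj : Disjoint (I.filter fun i => c i = n) (I.filter fun i => c i < n) :=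
      Finset.disjoint_filter.2 fun i _ h₁ h₂ => by omega
    have hstep : delayPath (p 0) g n * star (delayPath (p 0) g n) =
        delayPath (p 0) g (n + 1) * star (delayPath (p 0) g (n + 1)) +
          ∑ i ∈ I with c i = n, (delayPath (p 0) g (c i) * x i) *
            star (delayPath (p 0) g (c i) * x i) := by
      conv_lhs => rw [← h.delayPath_mul n, mul_assoc,
        star_mul, h.selfAdj, ← mul_assoc (p n), h.idem, hp n (by omega)]
      rw [add_mul, mul_add, Finset.sum_mul, Finset.mul_sum, delayPath, star_mul]
      congr 1
      · simp only [mul_assoc]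
      · refine Finset.sum_congr rfl fun i hi => ?_
        rw [(Finset.mem_filter.1 hi).2, star_mul]
        simp only [mul_assoc]
    rw [hsplit, Finset.sum_union hdisj, ← add_assoc, ← hstep]
    exact ih (by omega)

end IsDelaySeq

end DelayPath

namespace CKFamily

variable {A : Type} [NonUnitalCStarAlgebra A] {V E : Type} {r s : E → V} {S : E → A} {P : V → A}
  (h : CKFamily r s S P)
include h

theorem mul_proj_range (e : E) : S e * P (r e) = S e := by
  rw [← h.ck1, ← mul_assoc, h.partialIsom]

theorem proj_source_mul (e : E) : P (s e) * S e = S e := by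
  have := congrArg star (h.ck2 e)
  simp only [star_mul, star_star, h.projSelfAdj] at this
  rw [← h.partialIsom e, ← mul_assoc, this]

theorem star_mul_eq_zero {e f : E} (hef : e ≠ f) : star (S e) * S f = 0 := by
  have he : star (S e) * S e * star (S e) = star (S e) := by
    simpa [mul_assoc] using congrArg star (h.partialIsom e)
  rw [← he, ← h.partialIsom f]
  calc _ = star (S e) * ((S e * star (S e)) * (S f * star (S f))) * S f := by
        simp only [mul_assoc]
    _ = 0 := by rw [h.orthoRanges e f hef, mul_zero, zero_mul]

end CKFamily

section OutDelayProof

variable {A : Type} [NonUnitalCStarAlgebra A] {V E : Type} (d : V → ℕ∞)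

open scoped Classical in
/-- The partial isometry of the delay edge `f(v)^k`, extended by `0` to all `k`. -/
noncomputable def delayIso (S : ODEdge E d → A) (v : V) (k : ℕ) : A :=
  if h : 1 ≤ k ∧ (k : ℕ∞) ≤ d v then S (.inr ⟨(v, k), h⟩) else 0

open scoped Classical in
/-- The projection of the vertex `v^k`, extended by `0` to all `k`. -/
noncomputable def delayProj (P : ODVert d → A) (v : V) (k : ℕ) : A :=
  if h : (k : ℕ∞) ≤ d v then P ⟨(v, k), h⟩ else 0

variable {d} {r s : E → V} {dE : E → ℕ} {hsd : ∀ e, (dE e : ℕ∞) ≤ d (s e)}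
  {S : ODEdge E d → A} {P : ODVert d → A}

theorem delayProj_of_le {v : V} {k : ℕ} (hk : (k : ℕ∞) ≤ d v) :
    delayProj d P v k = P ⟨(v, k), hk⟩ := dif_pos hk

theorem delayProj_zero (v : V) : delayProj d P v 0 = QOD d P v := delayProj_of_le (by simp)

theorem delayIso_of_le {v : V} {k : ℕ} (hk : ((k + 1 : ℕ) : ℕ∞) ≤ d v) :
    delayIso d S v (k + 1) = S (.inr ⟨(v, k + 1), by simp, hk⟩) :=
  dif_pos ⟨by simp, hk⟩

theorem delayIso_of_not_le {v : V} {k : ℕ} (hk : ¬ (k : ℕ∞) ≤ d v) :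
    delayIso d S v k = 0 := dif_neg fun h => hk h.2

namespace CKFamily

variable (h : CKFamily (odRng r d) (odSrc s d dE hsd) S P)
include h

theorem isDelaySeq (v : V) : IsDelaySeq (delayProj d P v) (delayIso d S v) where
  idem k := by
    unfold delayProj
    split_ifs
    · exact h.projIdem _
    · exact mul_zero 0
  selfAdj k := by
    unfold delayProj
    split_ifs
    · exact h.projSelfAdj _
    · exact star_zero A
  star_mul_self k := by
    by_cases hk : ((k + 1 : ℕ) : ℕ∞) ≤ d v
    · rw [delayIso_of_le hk, delayProj_of_le hk]
      exact h.ck1 _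
    · rw [delayIso_of_not_le hk, mul_zero, delayProj, dif_neg hk]
  left_mul k := by
    by_cases hk : ((k + 1 : ℕ) : ℕ∞) ≤ d v
    · rw [delayIso_of_le hk, delayProj_of_le (le_trans (by exact_mod_cast k.le_succ) hk)]
      exact h.proj_source_mul (.inr ⟨(v, k + 1), by simp, hk⟩)
    · rw [delayIso_of_not_le hk, mul_zero]
  right_mul k := by
    by_cases hk : ((k + 1 : ℕ) : ℕ∞) ≤ d v
    · rw [delayIso_of_le hk, delayProj_of_le hk]
      exact h.mul_proj_range (.inr ⟨(v, k + 1), by simp, hk⟩)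
    · rw [delayIso_of_not_le hk, zero_mul]

theorem delayProj_mul (e : E) : delayProj d P (s e) (dE e) * S (.inl e) = S (.inl e) := by
  rw [delayProj_of_le (hsd e)]
  exact h.proj_source_mul (.inl e)

theorem TOD_eq (e : E) :
    TOD s d dE S e = delayPath (delayProj d P (s e) 0) (delayIso d S (s e)) (dE e) * S (.inl e) :=
  (h.isDelaySeq (s e)).chainR_eq _ _ (h.delayProj_mul e)

theorem star_TOD_mul_self (e : E) : star (TOD s d dE S e) * TOD s d dE S e = QOD d P (r e) := by
  rw [h.TOD_eq, star_mul, mul_assoc, ← mul_assoc (star (delayPath _ _ _)),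
    (h.isDelaySeq (s e)).star_delayPath_mul_self, h.delayProj_mul]
  exact h.ck1 (.inl e)

theorem TOD_mul_QOD (e : E) : TOD s d dE S e * QOD d P (r e) = TOD s d dE S e := by
  rw [h.TOD_eq, mul_assoc]
  exact congrArg _ (h.mul_proj_range (.inl e))

theorem QOD_mul_TOD (e : E) : QOD d P (s e) * TOD s d dE S e = TOD s d dE S e := by
  rw [h.TOD_eq, ← mul_assoc, ← delayProj_zero, (h.isDelaySeq (s e)).mul_delayPath]

theorem QOD_mul_QOD {v w : V} (hvw : v ≠ w) : QOD d P v * QOD d P w = 0 :=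
  h.orthoProj _ _ fun H => hvw (congrArg (fun x : ODVert d => x.1.1) H)

theorem star_QOD (v : V) : star (QOD d P v) = QOD d P v := h.projSelfAdj _

theorem star_inl_mul_delayIso (e : E) (v : V) (k : ℕ) :
    star (S (.inl e)) * delayIso d S v k = 0 := by
  unfold delayIso
  split_ifs
  · exact h.star_mul_eq_zero nofun
  · exact mul_zero _

theorem star_TOD_mul_TOD {e f : E} (hef : e ≠ f) :
    star (TOD s d dE S e) * TOD s d dE S f = 0 := by
  by_cases hs : s e = s f
  · wlog hle : dE e ≤ dE f generalizing e f
    · simpa using congrArg star (this hef.symm hs.symm (by omega))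
    have hseq := h.isDelaySeq (s f)
    rw [h.TOD_eq, h.TOD_eq, hs, star_mul, mul_assoc, ← mul_assoc (star (delayPath _ _ _))]
    rcases hle.eq_or_lt with heq | hlt
    · rw [heq, hseq.star_delayPath_mul_self, h.delayProj_mul]
      exact h.star_mul_eq_zero fun H => hef (Sum.inl_injective H)
    · obtain ⟨k, hk⟩ := Nat.exists_eq_add_of_le (Nat.succ_le_of_lt hlt)
      obtain ⟨y, hy⟩ := hseq.exists_star_delayPath_mul (dE e) k
      rw [hk, Nat.succ_eq_add_one, hy, ← mul_assoc, ← mul_assoc, h.star_inl_mul_delayIso,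
        zero_mul, zero_mul]
  · rw [← h.QOD_mul_TOD e, ← h.QOD_mul_TOD f, star_mul, h.star_QOD, mul_assoc,
      ← mul_assoc (QOD d P (s e)), h.QOD_mul_QOD hs, zero_mul, mul_zero]

theorem delayProj_eq_sum {v : V} {N n : ℕ} (hN : d v = N) (hn : n ≤ N) {I : Finset E}
    (hI : ∀ e, e ∈ I ↔ s e = v) (hmax : ∃ e, s e = v ∧ dE e = N) :
    delayProj d P v n = delayIso d S v (n + 1) * star (delayIso d S v (n + 1)) +
      ∑ e ∈ I with dE e = n, S (.inl e) * star (S (.inl e)) := by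
  classical
  have hn' : (n : ℕ∞) ≤ d v := hN ▸ by exact_mod_cast hn
  have key : ∀ K : Finset {p : V × ℕ // 1 ≤ p.2 ∧ (p.2 : ℕ∞) ≤ d p.1},
      (∀ g, g ∈ K ↔ g.1 = (v, n + 1)) → ((I.filter fun e => dE e = n).disjSum K).Nonempty →
      delayProj d P v n = ∑ g ∈ K, S (.inr g) * star (S (.inr g)) +
        ∑ e ∈ I with dE e = n, S (.inl e) * star (S (.inl e)) := by
    intro K hK hne
    have hset : {x : ODEdge E d | odSrc s d dE hsd x = ⟨(v, n), hn'⟩} =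
        (((I.filter fun e => dE e = n).disjSum K : Finset (E ⊕ _)) : Set (E ⊕ _)) := by
      ext x
      rcases x with e | ⟨⟨w, k⟩, hk⟩
      · have : odSrc s d dE hsd (.inl e) = ⟨(v, n), hn'⟩ ↔ s e = v ∧ dE e = n := by
          rw [odSrc]
          exact Subtype.ext_iff.trans Prod.ext_iff
        refine this.trans (Iff.trans ?_ (Finset.inl_mem_disjSum (s := I.filter _)).symm)
        simp [hI]
      · have : odSrc s d dE hsd (.inr ⟨(w, k), hk⟩) = ⟨(v, n), hn'⟩ ↔ w = v ∧ k - 1 = n := by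
          rw [odSrc]
          exact Subtype.ext_iff.trans Prod.ext_iff
        refine this.trans (Iff.trans ?_ Finset.inr_mem_disjSum.symm)
        have h1 : 1 ≤ k := hk.1
        simp only [hK, Prod.mk.injEq]
        exact and_congr_right fun _ => by omega
    rw [delayProj_of_le hn', h.ck3 ⟨(v, n), hn'⟩ (hset ▸ hne) (hset ▸ Finset.finite_toSet _), hset]
    refine (finsum_mem_coe_finset _ _).trans ((Finset.sum_disjSum _ _ _).trans (add_comm _ _))
  by_cases hlt : ((n + 1 : ℕ) : ℕ∞) ≤ d v
  · rw [delayIso_of_le hlt, key {⟨(v, n + 1), by simp, hlt⟩}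
      (fun g => by rw [Finset.mem_singleton, Subtype.ext_iff])
      ⟨.inr ⟨(v, n + 1), by simp, hlt⟩, by simp⟩, Finset.sum_singleton]
  · have hnN : N = n := by
      have : ¬ n + 1 ≤ N := fun H => hlt (hN ▸ by exact_mod_cast H)
      omega
    obtain ⟨e, he, heN⟩ := hmax
    rw [delayIso_of_not_le hlt, key ∅ _ ⟨.inl e, by simp [hI, he, heN, hnN]⟩, zero_mul,
      Finset.sum_empty]
    rintro ⟨_, hg⟩
    refine ⟨fun H => absurd H (Finset.notMem_empty _), ?_⟩
    rintro rfl
    exact absurd hg.2 hlt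

theorem QOD_eq_finsum {v : V}
    (hsup : d v = ⨆ e : {e // s e = v}, (dE e.1 : ℕ∞))
    (hne : {e | s e = v}.Nonempty) (hfin : {e | s e = v}.Finite) :
    QOD d P v = ∑ᶠ e ∈ {e | s e = v}, TOD s d dE S e * star (TOD s d dE S e) := by
  obtain ⟨e₀, he₀, hmax⟩ := Set.exists_max_image _ dE hfin hne
  have hN : d v = dE e₀ := hsup.trans <| le_antisymm
    (iSup_le fun e => by exact_mod_cast hmax e.1 e.2)
    (le_iSup (fun e : {e // s e = v} => (dE e.1 : ℕ∞)) ⟨e₀, he₀⟩)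
  have hI : ∀ e, e ∈ hfin.toFinset ↔ s e = v := fun e => hfin.mem_toFinset
  have hsum := (h.isDelaySeq v).eq_delayPath_add_sum hfin.toFinset dE (fun e => S (.inl e))
    (dE e₀ + 1) (fun n hn => h.delayProj_eq_sum hN (by omega) hI ⟨e₀, he₀, rfl⟩) _ le_rfl
  have hzero : delayIso d S v (dE e₀ + 1) = 0 :=
    delayIso_of_not_le (by rw [hN]; exact_mod_cast (Nat.lt_succ_self _).not_ge)
  rw [delayPath, hzero, mul_zero, zero_mul, zero_add, delayProj_zero] at hsum
  rw [finsum_mem_eq_finite_toFinset_sum _ hfin, hsum, Finset.filter_true_of_mem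
    fun e he => Nat.lt_succ_of_le (hmax e ((hI e).1 he))]
  refine Finset.sum_congr rfl fun e he => ?_
  rw [h.TOD_eq, (hI e).1 he, delayProj_zero]

end CKFamily

end OutDelayProof

/-- Let `E` be a directed graph (countable vertex and edge sets) and
`d_s` a Drinen source-vector for `E` (vertex part `d : V → ℕ∞`, edge part `dE : E → ℕ`;
the hypothesis `hsd` is the consequence `d_s e ≤ d_s (s e)` of axiom (i)).  If
`{s_f, p_w}` is a Cuntz-Krieger `d_s(E)`-family in a C*-algebra `A`, then `{T_e, Q_v}`
is a Cuntz-Krieger `E`-family in `A`; moreover if every `p_w` is nonzero then every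
`Q_v` is nonzero. -/
theorem outdelay_CK_family {A : Type} [NonUnitalCStarAlgebra A]
    {V E : Type} [Countable V] [Countable E] (r s : E → V)
    (d : V → ℕ∞) (dE : E → ℕ)
    (hsup : ∀ v, {e | s e = v}.Nonempty →
      d v = ⨆ e : {e // s e = v}, (dE e.1 : ℕ∞))
    (hinf : ∀ v, d v = ⊤ → ({e | s e = v} = ∅ ∨ {e | s e = v}.Infinite))
    (hsd : ∀ e, (dE e : ℕ∞) ≤ d (s e))
    (Sp : ODEdge E d → A) (Pp : ODVert d → A)
    (hfam : CKFamily (odRng r d) (odSrc s d dE hsd) Sp Pp) :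
    CKFamily r s (TOD s d dE Sp) (QOD d Pp) ∧
      ((∀ w, Pp w ≠ 0) → ∀ v, QOD d Pp v ≠ 0) := by
  refine ⟨⟨fun e => ?_, fun e f hef => ?_, fun v => hfam.projIdem _, hfam.star_QOD,
    fun v w => hfam.QOD_mul_QOD, hfam.star_TOD_mul_self, fun e => ?_,
    fun v hne hfin => hfam.QOD_eq_finsum (hsup v hne) hne hfin⟩, fun hP v => hP _⟩
  · rw [mul_assoc, hfam.star_TOD_mul_self, hfam.TOD_mul_QOD]
  · rw [mul_assoc, ← mul_assoc (star _), hfam.star_TOD_mul_TOD hef, zero_mul, mul_zero]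
  · rw [mul_assoc, ← hfam.star_QOD, ← star_mul, hfam.QOD_mul_TOD]
end

section
/- Let E be a directed graph, let d_s be a strictly proper Drinen source-vector for E, and let {s_f, p_w} be a Cuntz-Krieger d_s(E)-family in a C*-algebra A. Define Q_v = p_{v^0} for v ∈ E^0 and T_e = s_{f(s(e))^1} ⋯ s_{f(s(e))^{d_s(e)}} s_e for e ∈ E^1 (T_e = s_e when d_s(e) = 0). Then for all finite paths μ, ν in d_s(E) such that the source of μ is v^0 and the source of ν is w^0 for some v, w ∈ E^0 and r(μ) = r(ν), the element s_μ s_ν^* (where s_μ denotes the product s_{μ_1} ⋯ s_{μ_n} over the edges of μ, and s_μ = p_{v^0} for the empty path at v^0) lies in C*(T_e, Q_v), the smallest norm-closed star-subalgebra of A containing all T_e and Q_v. -/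
/-- `IsPath r s a b es` says that the list of edges `es` is a finite path from the
vertex `a` to the vertex `b` (consecutive edges compose, `r μᵢ = s μᵢ₊₁`); the empty
list is the path of length zero at `a = b`. -/
inductive IsPath {V' E' : Type} (rM sM : E' → V') : V' → V' → List E' → Prop
  | nil (v : V') : IsPath rM sM v v []
  | cons (e : E') (w : V') (es : List E') :
      IsPath rM sM (rM e) w es → IsPath rM sM (sM e) w (e :: es)

/-- `s_μ`: the product `s_{μ₁} ⋯ s_{μₙ}` over the edges of a path `μ`, with
`s_μ = p_v` for the empty path at `v`. -/
def pathElt {A : Type} [Mul A] {V' E' : Type} (S : E' → A) (P : V' → A) :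
    V' → List E' → A
  | v, [] => P v
  | _, [e] => S e
  | v, e :: f :: es => S e * pathElt S P v (f :: es)

namespace CKFamily

variable {A : Type} [NonUnitalCStarAlgebra A] {V E : Type} {r s : E → V} {S : E → A} {P : V → A}

theorem source_mul (h : CKFamily r s S P) (e : E) : P (s e) * S e = S e := by
  have h2 := congrArg star (h.ck2 e)
  simp only [star_mul, star_star, h.projSelfAdj] at h2
  calc P (s e) * S e = P (s e) * (S e * star (S e)) * S e := by
        rw [mul_assoc, h.partialIsom]
    _ = S e := by rw [h2, h.partialIsom]

theorem pathElt_cons (h : CKFamily r s S P) (v : V) (e : E) (es : List E) :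
    pathElt S P v (e :: es) = S e * pathElt S P (r e) es := by
  have base : ∀ (es : List E) (f : E) (v w : V),
      pathElt S P v (f :: es) = pathElt S P w (f :: es) := by
    intro es
    induction es with
    | nil => intros; rfl
    | cons g es ih => intro f v w; exact congrArg (S f * ·) (ih g v w)
  cases es with
  | nil => exact (h.mul_range e).symm
  | cons f es => exact congrArg (S e * ·) (base es f v (r e))

theorem source_mul_pathElt (h : CKFamily r s S P) {a c : V} {es : List E}
    (hp : IsPath r s a c es) : P a * pathElt S P a es = pathElt S P a es := by
  cases hp with
  | nil => exact h.projIdem a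
  | cons e _ es _ => rw [h.pathElt_cons, ← mul_assoc, h.source_mul]

end CKFamily

theorem chainR_succ {A : Type} [Semigroup A] (x : A) (g : ℕ → A) (n : ℕ) :
    chainR x g (n + 1) = chainR (g (n + 1) * x) g n := by
  induction n generalizing g with
  | zero => rfl
  | succ n ih => exact congrArg (g 1 * ·) (ih fun k => g (k + 1))

section DelayProduct

variable {V E : Type} {r s : E → V} {d : V → ℕ∞} {dE : E → ℕ}
variable {A : Type} [NonUnitalCStarAlgebra A]

open scoped Classical in
/-- The element `s_{f(v)^k}`, extended by zero to all `k`. -/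
noncomputable def delayElt (S : ODEdge E d → A) (v : V) (k : ℕ) : A :=
  if h : 1 ≤ k ∧ (k : ℕ∞) ≤ d v then S (.inr ⟨(v, k), h⟩) else 0

/-- The product `p_{v^0} s_{f(v)^1} ⋯ s_{f(v)^n}`. -/
noncomputable def delayProd (S : ODEdge E d → A) (P : ODVert d → A) (v : V) : ℕ → A
  | 0 => P (odVert0 d v)
  | n + 1 => delayProd S P v n * delayElt S v (n + 1)

theorem delayElt_of_le (S : ODEdge E d → A) {v : V} {k : ℕ} (h : 1 ≤ k ∧ (k : ℕ∞) ≤ d v) :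
    delayElt S v k = S (.inr ⟨(v, k), h⟩) := dif_pos h

theorem delayProd_mul (S : ODEdge E d → A) (P : ODVert d → A) (v : V) (n : ℕ) (x : A) :
    delayProd S P v n * x = P (odVert0 d v) * chainR x (delayElt S v) n := by
  induction n generalizing x with
  | zero => rfl
  | succ n ih => rw [chainR_succ, ← ih, delayProd, mul_assoc]

variable {hsd : ∀ e, (dE e : ℕ∞) ≤ d (s e)} {S : ODEdge E d → A} {P : ODVert d → A}

theorem odVert0_mul_delayElt_one (h : CKFamily (odRng r d) (odSrc s d dE hsd) S P) (v : V) :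
    P (odVert0 d v) * delayElt S v 1 = delayElt S v 1 := by
  by_cases hv : 1 ≤ 1 ∧ ((1 : ℕ) : ℕ∞) ≤ d v
  · rw [delayElt_of_le S hv]
    exact h.source_mul (.inr ⟨(v, 1), hv⟩)
  · rw [delayElt, dif_neg hv, mul_zero]

theorem delayProd_mul_edge (h : CKFamily (odRng r d) (odSrc s d dE hsd) S P) (e : E) :
    delayProd S P (s e) (dE e) * S (.inl e) = TOD s d dE S e := by
  rw [delayProd_mul]
  change _ = chainR (S (.inl e)) (delayElt S (s e)) (dE e)
  rcases hn : dE e with _ | n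
  · have hv : odVert0 d (s e) = odSrc s d dE hsd (.inl e) :=
      Subtype.ext (Prod.ext rfl hn.symm)
    rw [hv]
    exact h.source_mul (.inl e)
  · rw [chainR, ← mul_assoc]
    exact congrArg (· * _) (odVert0_mul_delayElt_one h (s e))

theorem delayProd_pred_mul_edge (g : {p : V × ℕ // 1 ≤ p.2 ∧ (p.2 : ℕ∞) ≤ d p.1}) :
    delayProd S P g.1.1 (g.1.2 - 1) * S (.inr g) = delayProd S P g.1.1 g.1.2 := by
  obtain ⟨⟨v, n⟩, hg⟩ := g
  obtain ⟨n, rfl⟩ : ∃ m, n = m + 1 := ⟨n - 1, (Nat.sub_add_cancel hg.1).symm⟩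
  exact congrArg (delayProd S P v n * ·) (delayElt_of_le S hg).symm

theorem delayProd_mul_vert (h : CKFamily (odRng r d) (odSrc s d dE hsd) S P) (a : ODVert d) :
    delayProd S P a.1.1 a.1.2 * P a = delayProd S P a.1.1 a.1.2 := by
  obtain ⟨⟨v, n⟩, ha⟩ := a
  cases n with
  | zero => exact h.projIdem _
  | succ n =>
    have hr := h.mul_range (.inr ⟨(v, n + 1), Nat.le_add_left 1 n, ha⟩)
    change delayProd S P v n * delayElt S v (n + 1) * _ = delayProd S P v n * _
    rw [delayElt_of_le S ⟨Nat.le_add_left 1 n, ha⟩, mul_assoc]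
    exact congrArg _ hr

theorem odVert0_mul_delayProd (h : CKFamily (odRng r d) (odSrc s d dE hsd) S P) (v : V) (n : ℕ) :
    P (odVert0 d v) * delayProd S P v n = delayProd S P v n := by
  induction n with
  | zero => exact h.projIdem _
  | succ n ih => rw [delayProd, ← mul_assoc, ih]

theorem exists_mem_delayProd_mul_pathElt (h : CKFamily (odRng r d) (odSrc s d dE hsd) S P)
    {B : NonUnitalStarSubalgebra ℂ A} (hT : ∀ e, TOD s d dE S e ∈ B)
    (hQ : ∀ v, QOD d P v ∈ B) {a c : ODVert d} {es : List (ODEdge E d)}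
    (hp : IsPath (odRng r d) (odSrc s d dE hsd) a c es) :
    ∃ b ∈ B, delayProd S P a.1.1 a.1.2 * pathElt S P a es =
      b * delayProd S P c.1.1 c.1.2 := by
  induction hp with
  | nil a =>
    refine ⟨_, hQ a.1.1, ?_⟩
    exact (delayProd_mul_vert h a).trans (odVert0_mul_delayProd h _ _).symm
  | cons e c es hp ih =>
    obtain ⟨b, hb, hbe⟩ := ih
    rw [h.pathElt_cons, ← mul_assoc]
    rcases e with e | g
    · refine ⟨_, mul_mem (hT e) hb, ?_⟩
      have hbr : P (odVert0 d (r e)) * pathElt S P (odVert0 d (r e)) es =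
          b * delayProd S P c.1.1 c.1.2 := hbe
      rw [mul_assoc (TOD s d dE S e), ← hbr, ← delayProd_mul_edge h e]
      exact congrArg (_ * ·) (h.source_mul_pathElt hp).symm
    · refine ⟨b, hb, ?_⟩
      rw [← hbe]
      exact congrArg (· * _) (delayProd_pred_mul_edge g)

theorem eq_of_odSrc_inr_eq {g : {p : V × ℕ // 1 ≤ p.2 ∧ (p.2 : ℕ∞) ≤ d p.1}} {a : ODVert d}
    (hg : odSrc s d dE hsd (.inr g) = a) : g.1 = (a.1.1, a.1.2 + 1) := by
  subst hg
  exact Prod.ext rfl (Nat.sub_add_cancel g.2.1).symm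

theorem finite_odSrc_fiber
    (hstrict : ∀ v, {e | s e = v}.Infinite → ∀ w : ODVert d, w.1.1 = v →
      {g : ODEdge E d | odSrc s d dE hsd g = w}.Infinite → (w.1.2 : ℕ∞) = d v)
    (a : ODVert d) (ha : ((a.1.2 + 1 : ℕ) : ℕ∞) ≤ d a.1.1) :
    {g : ODEdge E d | odSrc s d dE hsd g = a}.Finite := by
  by_contra hinf
  have hE : {e | s e = a.1.1}.Infinite := by
    intro hfin
    refine hinf (((hfin.image Sum.inl).union
      (Set.finite_singleton (Sum.inr ⟨(a.1.1, a.1.2 + 1), Nat.le_add_left _ _, ha⟩))).subset ?_)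
    rintro (e | g) hg
    · exact .inl ⟨e, congrArg (fun w : ODVert d => w.1.1) hg, rfl⟩
    · exact .inr (congrArg Sum.inr (Subtype.ext (eq_of_odSrc_inr_eq hg)))
  rw [← hstrict _ hE a rfl hinf, Nat.cast_le] at ha
  omega

theorem delayProd_mul_star_mem (h : CKFamily (odRng r d) (odSrc s d dE hsd) S P)
    (hstrict : ∀ v, {e | s e = v}.Infinite → ∀ w : ODVert d, w.1.1 = v →
      {g : ODEdge E d | odSrc s d dE hsd g = w}.Infinite → (w.1.2 : ℕ∞) = d v)
    {B : NonUnitalStarSubalgebra ℂ A} (hT : ∀ e, TOD s d dE S e ∈ B)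
    (hQ : ∀ v, QOD d P v ∈ B) (v : V) (n : ℕ) (hn : (n : ℕ∞) ≤ d v) :
    delayProd S P v n * star (delayProd S P v n) ∈ B := by
  classical
  induction n with
  | zero => exact mul_mem (hQ v) (star_mem (hQ v))
  | succ n ih =>
    have hn' : (n : ℕ∞) ≤ d v := le_trans (by exact_mod_cast n.le_succ) hn
    specialize ih hn'
    let a : ODVert d := ⟨(v, n), hn'⟩
    let f : ODEdge E d := .inr ⟨(v, n + 1), Nat.le_add_left _ _, hn⟩
    have hfin := finite_odSrc_fiber hstrict a hn
    have hf : f ∈ {g : ODEdge E d | odSrc s d dE hsd g = a} := rfl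
    have hP := h.ck3 a ⟨f, hf⟩ hfin
    rw [finsum_mem_eq_finite_toFinset_sum _ hfin,
      ← Finset.add_sum_erase _ _ (hfin.mem_toFinset.2 hf)] at hP
    set F := delayProd S P v n with hF
    have hFf : delayProd S P v (n + 1) = F * S f :=
      congrArg (F * ·) (delayElt_of_le S ⟨Nat.le_add_left _ _, hn⟩)
    have hFa : F * P a = F := delayProd_mul_vert h a
    have key : F * S f * star (F * S f) = F * star F -
        ∑ g ∈ hfin.toFinset.erase f, F * S g * star (F * S g) := by
      have hFF : F * star F = F * P a * star F := by rw [hFa]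
      rw [eq_sub_iff_add_eq, hFF, hP]
      simp only [mul_add, add_mul, Finset.mul_sum, Finset.sum_mul, star_mul, mul_assoc]
    rw [hFf, key]
    refine sub_mem ih (sum_mem fun g hg => ?_)
    obtain ⟨hgf, hg⟩ := Finset.mem_erase.1 hg
    have hga : odSrc s d dE hsd g = a := hfin.mem_toFinset.1 hg
    rcases g with e | g
    · have hv : s e = v := congrArg (fun w : ODVert d => w.1.1) hga
      have hd : dE e = n := congrArg (fun w : ODVert d => w.1.2) hga
      have hTe : F * S (.inl e) = TOD s d dE S e := by
        rw [← delayProd_mul_edge h e, hv, hd]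
      rw [hTe]
      exact mul_mem (hT e) (star_mem (hT e))
    · exact absurd (congrArg Sum.inr (Subtype.ext (eq_of_odSrc_inr_eq hga))) hgf

end DelayProduct

/-- Let `E` be a directed graph, `d_s` a strictly proper Drinen
source-vector and `{s_f, p_w}` a Cuntz-Krieger `d_s(E)`-family in a C*-algebra `A`.
With `Q_v = p_{v^0}` and `T_e = s_{f(s e)^1} ⋯ s_{f(s e)^{d_s e}} s_e`, every element
`s_μ s_ν^*`, for finite paths `μ, ν` of `d_s(E)` with sources of the form `v^0`, `w^0`
and common range, lies in `C*(T_e, Q_v)`, the smallest norm-closed star-subalgebra of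
`A` containing all the `T_e` and `Q_v`. -/
theorem outdelay_corner_mem {A : Type} [NonUnitalCStarAlgebra A]
    {V E : Type} [Countable V] [Countable E] (r s : E → V)
    (d : V → ℕ∞) (dE : E → ℕ)
    (hsup : ∀ v, {e | s e = v}.Nonempty →
      d v = ⨆ e : {e // s e = v}, (dE e.1 : ℕ∞))
    (hinf : ∀ v, d v = ⊤ → ({e | s e = v} = ∅ ∨ {e | s e = v}.Infinite))
    (hsd : ∀ e, (dE e : ℕ∞) ≤ d (s e))
    (hstrict : ∀ v, {e | s e = v}.Infinite → ∀ w : ODVert d, w.1.1 = v →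
      {g : ODEdge E d | odSrc s d dE hsd g = w}.Infinite → (w.1.2 : ℕ∞) = d v)
    (Sp : ODEdge E d → A) (Pp : ODVert d → A)
    (hfam : CKFamily (odRng r d) (odSrc s d dE hsd) Sp Pp) :
    ∀ (v w : V) (c : ODVert d) (μ ν : List (ODEdge E d)),
      IsPath (odRng r d) (odSrc s d dE hsd) (odVert0 d v) c μ →
      IsPath (odRng r d) (odSrc s d dE hsd) (odVert0 d w) c ν →
      pathElt Sp Pp (odVert0 d v) μ * star (pathElt Sp Pp (odVert0 d w) ν) ∈
        (NonUnitalStarAlgebra.adjoin ℂ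
          (Set.range (TOD s d dE Sp) ∪ Set.range (QOD d Pp))).topologicalClosure := by
  intro v w c μ ν hμ hν
  set B := NonUnitalStarAlgebra.adjoin ℂ
    (Set.range (TOD s d dE Sp) ∪ Set.range (QOD d Pp))
  have hT : ∀ e, TOD s d dE Sp e ∈ B := fun e =>
    NonUnitalStarAlgebra.subset_adjoin ℂ _ (.inl ⟨e, rfl⟩)
  have hQ : ∀ v, QOD d Pp v ∈ B := fun v =>
    NonUnitalStarAlgebra.subset_adjoin ℂ _ (.inr ⟨v, rfl⟩)
  obtain ⟨b, hb, hbμ⟩ := exists_mem_delayProd_mul_pathElt hfam hT hQ hμ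
  obtain ⟨b', hb', hbν⟩ := exists_mem_delayProd_mul_pathElt hfam hT hQ hν
  rw [← hfam.source_mul_pathElt hμ, ← hfam.source_mul_pathElt hν]
  refine B.le_topologicalClosure ?_
  change Pp (odVert0 d v) * _ = _ at hbμ
  change Pp (odVert0 d w) * _ = _ at hbν
  rw [hbμ, hbν, star_mul, mul_assoc, ← mul_assoc (delayProd Sp Pp c.1.1 c.1.2)]
  exact mul_mem hb (mul_mem
    (delayProd_mul_star_mem hfam hstrict hT hQ c.1.1 c.1.2 c.2) (star_mem hb'))
end

section
/- Let E be a directed graph, let d_r be a Drinen range-vector for E, and let d_r(E) be the in-delayed graph. Let {s_f, p_w : f ∈ d_r(E)^1, w ∈ d_r(E)^0} be a Cuntz-Krieger d_r(E)-family in a C*-algebra A. For v ∈ E^0 and e ∈ E^1 define Q_v = p_{v_0}, T_e = s_e if d_r(e) = 0, and T_e = s_e s_{f(r(e))_{d_r(e)}} ⋯ s_{f(r(e))_1} if d_r(e) ≠ 0. Then {T_e, Q_v : e ∈ E^1, v ∈ E^0} is a Cuntz-Krieger E-family in A; moreover, if every p_w is nonzero then every Q_v is nonzero. -/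
section InDelay

variable {V E : Type} (r s : E → V) (d : V → ℕ∞) (dE : E → ℕ)

/-- Vertices of the in-delayed graph `d_r(E)`: pairs `v_i = (v, i)` with
`0 ≤ i ≤ d_r v`. -/
def IDVert : Type := {p : V × ℕ // (p.2 : ℕ∞) ≤ d p.1}

/-- Edges of the in-delayed graph: the original edges `e ∈ E^1` together with the
delay edges `f(v)_i`, `1 ≤ i ≤ d_r v`, encoded as pairs `(v, i)`. -/
def IDEdge (E : Type) {V : Type} (d : V → ℕ∞) : Type :=
  E ⊕ {p : V × ℕ // 1 ≤ p.2 ∧ (p.2 : ℕ∞) ≤ d p.1}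

/-- The vertex `v_0` of the in-delayed graph. -/
def idVert0 (v : V) : IDVert d := ⟨(v, 0), by simp⟩

/-- The source map of the in-delayed graph: `s(e) = s(e)_0` and `s(f(v)_i) = v_i`. -/
def idSrc : IDEdge E d → IDVert d
  | .inl e => idVert0 d (s e)
  | .inr g => ⟨g.1, g.2.2⟩

/-- The range map of the in-delayed graph: `r(e) = r(e)_{d_r e}` and
`r(f(v)_i) = v_{i-1}`.  (The hypothesis `hrd`, that `d_r e ≤ d_r (r e)`, is a
consequence of the definition of a Drinen range-vector.) -/
def idRng (hrd : ∀ e, (dE e : ℕ∞) ≤ d (r e)) : IDEdge E d → IDVert d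
  | .inl e => ⟨(r e, dE e), hrd e⟩
  | .inr g => ⟨(g.1.1, g.1.2 - 1), le_trans (by exact_mod_cast Nat.sub_le _ _) g.2.2⟩

variable {A : Type} [Mul A]

/-- `chainL g x n = x * g n * g (n-1) * ⋯ * g 1` (and `chainL g x 0 = x`). -/
def chainL (g : ℕ → A) : A → ℕ → A
  | x, 0 => x
  | x, n + 1 => chainL g (x * g (n + 1)) n

end InDelay

section InDelayFamily

variable {V E : Type} (r s : E → V) (d : V → ℕ∞) (dE : E → ℕ)
variable {A : Type} [NonUnitalCStarAlgebra A]

open scoped Classical in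
/-- `T_e = s_e * s_{f(r e)_{d_r e}} ⋯ s_{f(r e)_1}` (and `T_e = s_e` when `d_r e = 0`). -/
noncomputable def TID (S : IDEdge E d → A) (e : E) : A :=
  chainL
    (fun k => if h : 1 ≤ k ∧ (k : ℕ∞) ≤ d (r e) then S (.inr ⟨(r e, k), h⟩) else 0)
    (S (.inl e)) (dE e)

/-- `Q_v = p_{v_0}`. -/
noncomputable def QID (P : IDVert d → A) (v : V) : A := P (idVert0 d v)

end InDelayFamily

/-- A chain of composable partial isometries `x, g n, …, g 1`, in which the range projection
`p k` of `g k` is the source projection of the preceding factor, has the range projection of `x`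
and the source projection `p 0`. -/
lemma chainL_partialIsometry {A : Type} [NonUnitalCStarAlgebra A] (g p : ℕ → A) (n : ℕ)
    (hg : ∀ k, 1 ≤ k → k ≤ n → g k * star (g k) * g k = g k)
    (hr : ∀ k, 1 ≤ k → k ≤ n → g k * star (g k) = p k)
    (hs : ∀ k, 1 ≤ k → k ≤ n → star (g k) * g k = p (k - 1))
    (x : A) (hx : x * p n = x) (hxs : star x * x = p n) :
    chainL g x n * star (chainL g x n) = x * star x ∧
      star (chainL g x n) * chainL g x n = p 0 ∧ chainL g x n * p 0 = chainL g x n := by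
  induction n generalizing x with
  | zero => exact ⟨rfl, hxs, hx⟩
  | succ n ih =>
    have hg' := hg (n + 1) (by omega) le_rfl
    have hr' := hr (n + 1) (by omega) le_rfl
    have hs' := hs (n + 1) (by omega) le_rfl
    rw [Nat.add_sub_cancel] at hs'
    obtain ⟨h₁, h₂⟩ := ih (fun k h h' => hg k h (by omega)) (fun k h h' => hr k h (by omega))
      (fun k h h' => hs k h (by omega)) (x * g (n + 1))
      (by rw [← hs', mul_assoc, ← mul_assoc (g (n + 1)), hg'])
      (by
        rw [star_mul, mul_assoc, ← mul_assoc (star x), hxs, ← hr', hg', hs'])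
    refine ⟨h₁.trans ?_, h₂⟩
    rw [star_mul, mul_assoc, ← mul_assoc (g (n + 1)), hr', ← mul_assoc, hx]

section InDelayLemmas

variable {A : Type} [NonUnitalCStarAlgebra A] {V E : Type} {r s : E → V}
  {d : V → ℕ∞} {dE : E → ℕ} {hrd : ∀ e, (dE e : ℕ∞) ≤ d (r e)}
  {S : IDEdge E d → A} {P : IDVert d → A}

lemma idVert0_injective : Function.Injective (idVert0 d) := fun _ _ h =>
  congrArg (fun w : IDVert d => w.1.1) h

/-- The edges leaving `v_0` are exactly the original edges leaving `v`. -/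
lemma setOf_idSrc_eq_idVert0 (v : V) :
    {f : IDEdge E d | idSrc s d f = idVert0 d v} =
      (Sum.inl : E → IDEdge E d) '' {e | s e = v} := by
  ext f
  rcases f with e | g
  · constructor
    · intro h
      exact ⟨e, idVert0_injective h, rfl⟩
    · rintro ⟨e', h, he⟩
      cases he
      exact congrArg (idVert0 d) h
  · constructor
    · intro h
      have h0 : g.1.2 = 0 := congrArg (fun w : IDVert d => w.1.2) h
      have := g.2.1
      omega
    · rintro ⟨e', _, he⟩
      cases he

/-- The delay edge `f(v)_i` is the only edge leaving `v_i`. -/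
lemma setOf_idSrc_eq_delay (g : {p : V × ℕ // 1 ≤ p.2 ∧ (p.2 : ℕ∞) ≤ d p.1}) :
    {f : IDEdge E d | idSrc s d f = ⟨g.1, g.2.2⟩} = {(Sum.inr g : IDEdge E d)} := by
  ext f
  rcases f with e | g'
  · constructor
    · intro h
      have h0 : 0 = g.1.2 := congrArg (fun w : IDVert d => w.1.2) h
      have := g.2.1
      omega
    · intro h
      cases h
  · constructor
    · intro h
      have h0 : g'.1 = g.1 := congrArg (fun w : IDVert d => w.1) h
      exact congrArg Sum.inr (Subtype.ext h0)
    · intro h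
      cases h
      rfl

lemma CKFamily.range_delay (h : CKFamily (idRng r d dE hrd) (idSrc s d) S P)
    (g : {p : V × ℕ // 1 ≤ p.2 ∧ (p.2 : ℕ∞) ≤ d p.1}) :
    S (.inr g) * star (S (.inr g)) = P ⟨g.1, g.2.2⟩ := by
  have hset := setOf_idSrc_eq_delay (s := s) g
  have h3 := h.ck3 ⟨g.1, g.2.2⟩ (by rw [hset]; exact Set.singleton_nonempty _)
    (by rw [hset]; exact Set.finite_singleton _)
  rw [hset] at h3
  exact (h3.trans (finsum_mem_singleton (f := fun f => S f * star (S f)))).symm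

open scoped Classical in
lemma CKFamily.TID_spec (h : CKFamily (idRng r d dE hrd) (idSrc s d) S P) (e : E) :
    TID r d dE S e * star (TID r d dE S e) = S (.inl e) * star (S (.inl e)) ∧
      star (TID r d dE S e) * TID r d dE S e = QID d P (r e) ∧
      TID r d dE S e * QID d P (r e) = TID r d dE S e := by
  have hle : ∀ k, k ≤ dE e → (k : ℕ∞) ≤ d (r e) := fun k hk =>
    le_trans (by exact_mod_cast hk) (hrd e)
  let p : ℕ → A := fun k => if hk : (k : ℕ∞) ≤ d (r e) then P ⟨(r e, k), hk⟩ else 0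
  have hp : ∀ (k : ℕ) (hk : (k : ℕ∞) ≤ d (r e)), p k = P ⟨(r e, k), hk⟩ := fun k hk => dif_pos hk
  have hs : star (S (.inl e)) * S (.inl e) = p (dE e) := by
    rw [hp _ (hrd e)]
    exact h.ck1 (.inl e)
  have key := chainL_partialIsometry
    (fun k => if h : 1 ≤ k ∧ (k : ℕ∞) ≤ d (r e) then S (.inr ⟨(r e, k), h⟩) else 0)
    p (dE e) ?_ ?_ ?_ (S (.inl e)) (by rw [← hs, ← mul_assoc]; exact h.partialIsom _) hs
  · rwa [hp 0 (by simp)] at key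
  all_goals
    intro k hk hk'
    simp only [dif_pos (show 1 ≤ k ∧ (k : ℕ∞) ≤ d (r e) from ⟨hk, hle k hk'⟩)]
  · exact h.partialIsom _
  · rw [hp k (hle k hk')]
    exact h.range_delay ⟨(r e, k), hk, hle k hk'⟩
  · rw [hp (k - 1) (hle _ (by omega))]
    exact h.ck1 (.inr ⟨(r e, k), hk, hle k hk'⟩)

end InDelayLemmas

/-- Let `E` be a directed graph (countable vertex and edge sets) and
`d_r` a Drinen range-vector for `E` (vertex part `d : V → ℕ∞`, edge part `dE : E → ℕ`;
the hypothesis `hrd` is the consequence `d_r e ≤ d_r (r e)` of axiom (i)).  If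
`{s_f, p_w}` is a Cuntz-Krieger `d_r(E)`-family in a C*-algebra `A`, then `{T_e, Q_v}`
is a Cuntz-Krieger `E`-family in `A`; moreover if every `p_w` is nonzero then every
`Q_v` is nonzero. -/
theorem indelay_CK_family {A : Type} [NonUnitalCStarAlgebra A]
    {V E : Type} [Countable V] [Countable E] (r s : E → V)
    (d : V → ℕ∞) (dE : E → ℕ)
    (hsup : ∀ v, {e | r e = v}.Nonempty →
      d v = ⨆ e : {e // r e = v}, (dE e.1 : ℕ∞))
    (hinf : ∀ v, d v = ⊤ → ({e | r e = v} = ∅ ∨ {e | r e = v}.Infinite))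
    (hrd : ∀ e, (dE e : ℕ∞) ≤ d (r e))
    (Sp : IDEdge E d → A) (Pp : IDVert d → A)
    (hfam : CKFamily (idRng r d dE hrd) (idSrc s d) Sp Pp) :
    CKFamily r s (TID r d dE Sp) (QID d Pp) ∧
      ((∀ w, Pp w ≠ 0) → ∀ v, QID d Pp v ≠ 0) := by
  refine ⟨?_, fun hP v => hP _⟩
  have hT := fun e => (hfam.TID_spec e).1
  refine
    { partialIsom := fun e => ?_
      orthoRanges := fun e f hef => ?_
      projIdem := fun v => hfam.projIdem _
      projSelfAdj := fun v => hfam.projSelfAdj _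
      orthoProj := fun v w hvw => hfam.orthoProj _ _ (idVert0_injective.ne hvw)
      ck1 := fun e => (hfam.TID_spec e).2.1
      ck2 := fun e => ?_
      ck3 := fun v hne hfin => ?_ }
  · rw [mul_assoc, (hfam.TID_spec e).2.1, (hfam.TID_spec e).2.2]
  · rw [hT, hT]
    exact hfam.orthoRanges _ _ (Sum.inl_injective.ne hef)
  · rw [hT]
    exact hfam.ck2 (.inl e)
  · have hset := setOf_idSrc_eq_idVert0 (d := d) (s := s) v
    have h3 := hfam.ck3 (idVert0 d v) (by rw [hset]; exact hne.image _)
      (by rw [hset]; exact hfin.image _)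
    rw [hset] at h3
    simp only [hT]
    exact h3.trans (finsum_mem_image (f := fun f => Sp f * star (Sp f))
      Sum.inl_injective.injOn)
end

section
/- Let E be a directed graph with no sinks, let P be any partition of E^1 as in the out-splitting construction, and let E_s(P) be the out-split graph formed from E using P (with its vertex set taken disjoint from E^0). Then E is elementary strong shift equivalent to E_s(P): there exists a directed graph E_3 with vertex set E^0 ∪ E_s(P)^0, all of whose edges go from E^0 to E_s(P)^0 or from E_s(P)^0 to E^0, together with range- and source-preserving bijections θ_1 from E^1 onto the paths of length 2 in E_3 beginning and ending in E^0, and θ_2 from E_s(P)^1 onto the paths of length 2 in E_3 beginning and ending in E_s(P)^0. -/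
/-- Let `E` be a directed graph (countable vertex and edge sets)
with no sinks, `𝓟` any partition of `E^1` in the out-splitting sense (encoded by
`m : V → ℕ∞` and `idx : E → ℕ`), and `E_s(𝓟)` the out-split graph (whose vertex set is
disjoint from `E^0`; here they form the two summands of `V ⊕ OSVert m`).  Then `E` is
elementary strong shift equivalent to `E_s(𝓟)`: there is a directed graph `E_3` on the
vertex set `E^0 ⊔ E_s(𝓟)^0`, all of whose edges go from one side to the other, together
with source- and range-preserving bijections `θ₁` from `E^1` onto the paths of length
two in `E_3` beginning and ending in `E^0`, and `θ₂` from `E_s(𝓟)^1` onto the paths of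
length two in `E_3` beginning and ending in `E_s(𝓟)^0`. -/
theorem outsplit_ESSE
    {V E : Type} [Countable V] [Countable E] (r s : E → V)
    (m : V → ℕ∞) (idx : E → ℕ)
    (hnosink : ∀ v : V, ∃ e : E, s e = v)
    (hsink : ∀ v, m v = 0 ↔ {e | s e = v} = ∅)
    (hidx : ∀ e, 1 ≤ idx e ∧ (idx e : ℕ∞) ≤ m (s e))
    (hcls : ∀ v k, 1 ≤ k → (k : ℕ∞) ≤ m v → ∃ e, s e = v ∧ idx e = k) :
    ∃ (E3 : Type) (_ : Countable E3) (s3 r3 : E3 → V ⊕ OSVert m),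
      (∀ g : E3,
        ((∃ v, s3 g = Sum.inl v) ∧ (∃ w, r3 g = Sum.inr w)) ∨
        ((∃ w, s3 g = Sum.inr w) ∧ (∃ v, r3 g = Sum.inl v))) ∧
      (∃ θ1 : E → {p : E3 × E3 // r3 p.1 = s3 p.2 ∧
          (∃ v, s3 p.1 = Sum.inl v) ∧ (∃ v, r3 p.2 = Sum.inl v)},
        Function.Bijective θ1 ∧
        ∀ e : E, s3 (θ1 e).1.1 = Sum.inl (s e) ∧ r3 (θ1 e).1.2 = Sum.inl (r e)) ∧
      (∃ θ2 : OSEdge r m → {p : E3 × E3 // r3 p.1 = s3 p.2 ∧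
          (∃ w, s3 p.1 = Sum.inr w) ∧ (∃ w, r3 p.2 = Sum.inr w)},
        Function.Bijective θ2 ∧
        ∀ f : OSEdge r m,
          s3 (θ2 f).1.1 = Sum.inr (osSrc r s m idx hidx f) ∧
          r3 (θ2 f).1.2 = Sum.inr (osRng r m f)) := by
  have hV : Countable (OSVert m) := Subtype.countable
  let tail : E → OSVert m := fun e => ⟨(s e, idx e), Or.inr (hidx e)⟩
  refine ⟨OSVert m ⊕ E, inferInstance,
    Sum.elim (fun x => Sum.inl x.1.1) (fun e => Sum.inr (tail e)),
    Sum.elim (fun x => Sum.inr x) (fun e => Sum.inl (r e)), ?_, ?_, ?_⟩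
  · rintro (x | e)
    · exact Or.inl ⟨⟨_, rfl⟩, ⟨_, rfl⟩⟩
    · exact Or.inr ⟨⟨_, rfl⟩, ⟨_, rfl⟩⟩
  · refine ⟨fun e => ⟨(Sum.inl (tail e), Sum.inr e), rfl, ⟨_, rfl⟩, ⟨_, rfl⟩⟩,
      ⟨fun e e' h => ?_, ?_⟩, fun e => ⟨rfl, rfl⟩⟩
    · exact Sum.inr_injective (congrArg (fun p => p.1.2) h)
    · rintro ⟨⟨x | e, y | e'⟩, h, ⟨v, hv⟩, ⟨w, hw⟩⟩
      · exact nomatch hw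
      · obtain rfl : x = tail e' := Sum.inr_injective h
        exact ⟨e', rfl⟩
      · exact nomatch hv
      · exact nomatch hv
  · refine ⟨fun f => ⟨(Sum.inr f.1.1, Sum.inl (osRng r m f)), rfl, ⟨_, rfl⟩, ⟨_, rfl⟩⟩,
      ⟨fun f f' h => ?_, ?_⟩, fun f => ⟨rfl, rfl⟩⟩
    · have h₁ : f.1.1 = f'.1.1 := Sum.inr_injective (congrArg (fun p => p.1.1) h)
      have h₂ : osRng r m f = osRng r m f' := Sum.inl_injective (congrArg (fun p => p.1.2) h)
      exact Subtype.ext (Prod.ext h₁ (congrArg (fun x => x.1.2) h₂))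
    · rintro ⟨⟨x | e, y | e'⟩, h, ⟨v, hv⟩, ⟨w, hw⟩⟩
      · exact nomatch hv
      · exact nomatch hv
      · obtain ⟨⟨u, j⟩, hy⟩ := y
        obtain rfl : r e = u := Sum.inl_injective h
        exact ⟨⟨(e, j), hy⟩, rfl⟩
      · exact nomatch hw
end

section
/- Let E be a directed graph with no sinks, let P be any partition of E^1 as in the in-splitting construction, and let E_r(P) be the in-split graph formed from E using P (with its vertex set taken disjoint from E^0). Then E is elementary strong shift equivalent to E_r(P): there exists a directed graph E_3 with vertex set E^0 ∪ E_r(P)^0, all of whose edges go from E^0 to E_r(P)^0 or from E_r(P)^0 to E^0, together with range- and source-preserving bijections θ_1 from E^1 onto the paths of length 2 in E_3 beginning and ending in E^0, and θ_2 from E_r(P)^1 onto the paths of length 2 in E_3 beginning and ending in E_r(P)^0. -/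
/-! Statement 12: a directed graph with no sinks is elementary strong shift equivalent
to any of its in-splittings. -/

section InSplit

variable {V E : Type} (r s : E → V) (m : V → ℕ∞) (idx : E → ℕ)

/-- Vertices of the in-split graph `E_r(P)`: pairs `v_i = (v, i)` with `1 ≤ i ≤ m v`,
together with the sources `v`, encoded as `(v, 0)` when `m v = 0`. -/
def ISVert : Type :=
  {p : V × ℕ // (p.2 = 0 ∧ m p.1 = 0) ∨ (1 ≤ p.2 ∧ (p.2 : ℕ∞) ≤ m p.1)}

/-- Edges of the in-split graph: pairs `e_j = (e, j)` with `1 ≤ j ≤ m (s e)`, together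
with the edges `e` out of sources, encoded as `(e, 0)` when `m (s e) = 0`. -/
def ISEdge : Type :=
  {p : E × ℕ // (p.2 = 0 ∧ m (s p.1) = 0) ∨ (1 ≤ p.2 ∧ (p.2 : ℕ∞) ≤ m (s p.1))}

/-- The source map of the in-split graph: `s(e_j) = s(e)_j` (and `s(e) = s(e)` for
sources). -/
def isSrc : ISEdge s m → ISVert m := fun g => ⟨(s g.1.1, g.1.2), g.2⟩

/-- The range map of the in-split graph: `r(e_j) = r(e)_i` where `e ∈ 𝓔^{r e}_i`,
i.e. `i = idx e`. -/
def isRng (hidx : ∀ e, 1 ≤ idx e ∧ (idx e : ℕ∞) ≤ m (r e)) :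
    ISEdge s m → ISVert m :=
  fun g => ⟨(r g.1.1, idx g.1.1), Or.inr (hidx g.1.1)⟩

end InSplit

/-- Let `E` be a directed graph (countable vertex and edge sets)
with no sinks, `𝓟` any partition of `E^1` in the in-splitting sense (encoded by
`m : V → ℕ∞` and `idx : E → ℕ`), and `E_r(𝓟)` the in-split graph (whose vertex set is
disjoint from `E^0`; here they form the two summands of `V ⊕ ISVert m`).  Then `E` is
elementary strong shift equivalent to `E_r(𝓟)`: there is a directed graph `E_3` on the
vertex set `E^0 ⊔ E_r(𝓟)^0`, all of whose edges go from one side to the other, together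
with source- and range-preserving bijections `θ₁` from `E^1` onto the paths of length
two in `E_3` beginning and ending in `E^0`, and `θ₂` from `E_r(𝓟)^1` onto the paths of
length two in `E_3` beginning and ending in `E_r(𝓟)^0`. -/
theorem insplit_ESSE
    {V E : Type} [Countable V] [Countable E] (r s : E → V)
    (m : V → ℕ∞) (idx : E → ℕ)
    (hnosink : ∀ v : V, ∃ e : E, s e = v)
    (hsource : ∀ v, m v = 0 ↔ {e | r e = v} = ∅)
    (hidx : ∀ e, 1 ≤ idx e ∧ (idx e : ℕ∞) ≤ m (r e))
    (hcls : ∀ v k, 1 ≤ k → (k : ℕ∞) ≤ m v → ∃ e, r e = v ∧ idx e = k) :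
    ∃ (E3 : Type) (_ : Countable E3) (s3 r3 : E3 → V ⊕ ISVert m),
      (∀ g : E3,
        ((∃ v, s3 g = Sum.inl v) ∧ (∃ w, r3 g = Sum.inr w)) ∨
        ((∃ w, s3 g = Sum.inr w) ∧ (∃ v, r3 g = Sum.inl v))) ∧
      (∃ θ1 : E → {p : E3 × E3 // r3 p.1 = s3 p.2 ∧
          (∃ v, s3 p.1 = Sum.inl v) ∧ (∃ v, r3 p.2 = Sum.inl v)},
        Function.Bijective θ1 ∧
        ∀ e : E, s3 (θ1 e).1.1 = Sum.inl (s e) ∧ r3 (θ1 e).1.2 = Sum.inl (r e)) ∧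
      (∃ θ2 : ISEdge s m → {p : E3 × E3 // r3 p.1 = s3 p.2 ∧
          (∃ w, s3 p.1 = Sum.inr w) ∧ (∃ w, r3 p.2 = Sum.inr w)},
        Function.Bijective θ2 ∧
        ∀ f : ISEdge s m,
          s3 (θ2 f).1.1 = Sum.inr (isSrc s m f) ∧
          r3 (θ2 f).1.2 = Sum.inr (isRng r s m idx hidx f)) := by
  have : Countable (ISVert m) :=
    inferInstanceAs (Countable {p : V × ℕ //
      (p.2 = 0 ∧ m p.1 = 0) ∨ (1 ≤ p.2 ∧ (p.2 : ℕ∞) ≤ m p.1)})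
  let rv : E → ISVert m := fun e => ⟨(r e, idx e), Or.inr (hidx e)⟩
  let s3 : E ⊕ ISVert m → V ⊕ ISVert m := Sum.elim (fun e => Sum.inl (s e)) Sum.inr
  let r3 : E ⊕ ISVert m → V ⊕ ISVert m :=
    Sum.elim (fun e => Sum.inr (rv e)) (fun w => Sum.inl w.1.1)
  refine ⟨E ⊕ ISVert m, inferInstance, s3, r3, ?_, ?_, ?_⟩
  · rintro (e | w)
    · exact Or.inl ⟨⟨s e, rfl⟩, ⟨rv e, rfl⟩⟩
    · exact Or.inr ⟨⟨w, rfl⟩, ⟨w.1.1, rfl⟩⟩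
  · refine ⟨fun e => ⟨(Sum.inl e, Sum.inr (rv e)), rfl, ⟨s e, rfl⟩, ⟨r e, rfl⟩⟩,
      ⟨fun e f h => ?_, ?_⟩, fun e => ⟨rfl, rfl⟩⟩
    · exact Sum.inl_injective (congrArg (fun p => p.1.1) h)
    · rintro ⟨⟨e | w, f | w'⟩, h, ⟨v, hv⟩, ⟨v', hv'⟩⟩
      · cases hv'
      · obtain rfl : rv e = w' := Sum.inr_injective h
        exact ⟨e, rfl⟩
      · cases hv
      · cases hv
  · refine ⟨fun g => ⟨(Sum.inr (isSrc s m g), Sum.inl g.1.1), rfl, ⟨isSrc s m g, rfl⟩,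
      ⟨rv g.1.1, rfl⟩⟩, ⟨fun g g' h => ?_, ?_⟩, fun g => ⟨rfl, rfl⟩⟩
    · have hw : isSrc s m g = isSrc s m g' :=
        Sum.inr_injective (congrArg (fun p => p.1.1) h)
      have he : g.1.1 = g'.1.1 := Sum.inl_injective (congrArg (fun p => p.1.2) h)
      exact Subtype.ext (Prod.ext he (congrArg (fun w : ISVert m => w.1.2) hw))
    · rintro ⟨⟨e | w, f | w'⟩, h, ⟨v, hv⟩, ⟨v', hv'⟩⟩
      · cases hv
      · cases hv
      · obtain ⟨⟨x, i⟩, hw⟩ := w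
        obtain rfl : x = s f := Sum.inl_injective h
        exact ⟨⟨(f, i), hw⟩, rfl⟩
      · cases hv'
end
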